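/- arXiv:2312.08784 — 3 statements merged into one kernel-verified Lean document; each statement's English description precedes it below -/
import Mathlib

section
/- Let α ∈ (1/2,1), σ > 0, φ(t) = ασ(1+σt)^{-(α+1)}, and let R_α(t) = ∑_{k=1}^∞ φ^{*k}(t). Then R_α is completely monotone on (0,∞): R_α is infinitely differentiable on (0,∞) and (−1)^k R_α^{(k)}(t) ≥ 0 for every integer k ≥ 0 and every t > 0. -/
open MeasureTheory Real Filter Set

/-- Convolution of two functions on `[0,∞)`: `(f * g)(t) = ∫_0^t f(t-s) g(s) ds`. -/
noncomputable def conv (f g : ℝ → ℝ) : ℝ → ℝ := fun t => ∫ s in (0:ℝ)..t, f (t - s) * g s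

/-- Convolution powers: `convPow f k = f^{*(k+1)}`, i.e. `convPow f 0 = f`. -/
noncomputable def convPow (f : ℝ → ℝ) : ℕ → ℝ → ℝ
  | 0 => f
  | (k + 1) => conv f (convPow f k)

namespace RCM

/-- The solution of the scalar linear equation with rate x, source R and initial value one. -/
noncomputable def U (R : ℝ → ℝ) (t x : ℝ) : ℝ :=
  exp (-(x * t)) + ∫ s in (0:ℝ)..t, exp (-(x * (t - s))) * R s

lemma U_eq (R : ℝ → ℝ) (t x : ℝ) :
    U R t x = exp (-(x * t)) + exp (-(x * t)) * ∫ s in (0:ℝ)..t, exp (x * s) * R s := by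
  unfold U
  rw [← intervalIntegral.integral_const_mul]
  congr 2
  ext s
  rw [← mul_assoc, ← Real.exp_add]
  ring_nf

lemma U_hasDerivAt (R : ℝ → ℝ) (hR : Continuous R) (t x : ℝ) :
    HasDerivAt (fun t => U R t x) (-x * U R t x + R t) t := by
  have h1 : HasDerivAt (fun t => exp (-(x * t))) (exp (-(x * t)) * (-x)) t := by
    have := ((hasDerivAt_id t).const_mul x).neg.exp
    simpa using this
  have h2 : HasDerivAt (fun t => ∫ s in (0:ℝ)..t, exp (x * s) * R s) (exp (x * t) * R t) t := by
    have hc : Continuous (fun s => exp (x * s) * R s) := by fun_prop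
    exact intervalIntegral.integral_hasDerivAt_right (hc.intervalIntegrable _ _)
      (hc.stronglyMeasurableAtFilter _ _) hc.continuousAt
  have h3 := h1.add (h1.mul h2)
  have : (fun t => U R t x) = ((fun t => exp (-(x * t))) +
      (fun t => exp (-(x * t))) * fun t => ∫ s in (0:ℝ)..t, exp (x * s) * R s) := by
    ext t; simp [U_eq]
  rw [this]
  refine h3.congr_deriv ?_
  rw [U_eq]
  have : exp (-(x*t)) * (exp (x*t) * R t) = R t := by
    rw [← mul_assoc, ← Real.exp_add]; simp
  rw [this]; ring

lemma U_continuous (R : ℝ → ℝ) (hR : Continuous R) (t : ℝ) : Continuous (U R t) := by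
  unfold U
  refine Continuous.add (by fun_prop) ?_
  exact intervalIntegral.continuous_parametric_intervalIntegral_of_continuous
    (f := fun x s => exp (-(x * (t - s))) * R s) (by fun_prop) continuous_const

/-- uniqueness for the scalar ODE -/
lemma eq_U (R v : ℝ → ℝ) (hR : Continuous R) (x : ℝ)
    (hv : ∀ t, HasDerivAt v (-x * v t + R t) t) (h0 : v 0 = 1) (t : ℝ) : v t = U R t x := by
  have hd : ∀ s, HasDerivAt (fun s => exp (x * s) * v s) (exp (x * s) * R s) s := by
    intro s
    have h1 : HasDerivAt (fun t => exp (x * t)) (exp (x * s) * x) s := by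
      simpa using ((hasDerivAt_id s).const_mul x).exp
    refine (h1.mul (hv s)).congr_deriv ?_
    ring
  have hc : Continuous (fun s => exp (x * s) * R s) := by fun_prop
  have := intervalIntegral.integral_eq_sub_of_hasDerivAt (a := 0) (b := t) (fun s _ => hd s)
    (hc.intervalIntegrable _ _)
  rw [U_eq, this]
  simp only [mul_zero, Real.exp_zero, h0]
  have : exp (-(x*t)) * (exp (x*t) * v t) = v t := by
    rw [← mul_assoc, ← Real.exp_add]; simp
  rw [mul_sub, this]; ring

section absop

variable {E : Type*} [NormedAddCommGroup E] [NormedSpace ℝ E]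

lemma abs_pow_symm (B : E →L[ℝ] E) (Q : E → E →L[ℝ] ℝ)
    (hB : ∀ f g, Q f (B g) = Q (B f) g) (n : ℕ) : ∀ f g,
    Q f ((B ^ n) g) = Q ((B ^ n) f) g := by
  induction n with
  | zero => intro f g; simp
  | succ n ih =>
    intro f g
    have h1 : (B ^ (n+1)) g = (B ^ n) (B g) := by rw [pow_succ]; rfl
    have h2 : (B ^ (n+1)) f = B ((B ^ n) f) := by rw [pow_succ']; rfl
    rw [h1, h2, ih, hB]

lemma abs_exp_symm [CompleteSpace E] (B : E →L[ℝ] E) (Q : E → E →L[ℝ] ℝ)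
    (hQ : ∀ f g, Q f g = Q g f)
    (hB : ∀ f g, Q f (B g) = Q (B f) g) (t : ℝ) (f g : E) :
    Q f (NormedSpace.exp (t • B) g) = Q (NormedSpace.exp (t • B) f) g := by
  have hs := NormedSpace.exp_series_hasSum_exp' (𝕂 := ℝ) (t • B)
  have hg : ∀ g : E, HasSum (fun n : ℕ => ((n.factorial : ℝ)⁻¹ • (t • B) ^ n) g)
      (NormedSpace.exp (t • B) g) := fun g =>
    hs.mapL (ContinuousLinearMap.apply ℝ E g)
  have h1 := (hg g).mapL (Q f)
  have h2 := (hg f).mapL (Q g)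
  rw [hQ _ g]
  refine h1.unique ?_
  convert h2 using 2 with n
  have : (t • B) ^ n = t ^ n • B ^ n := smul_pow t B n
  rw [this]
  simp only [_root_.smul_apply, map_smul]
  rw [abs_pow_symm B Q hB, hQ]

lemma abs_op [CompleteSpace E] (B : E →L[ℝ] E) (Q : E → E →L[ℝ] ℝ)
    (hQ : ∀ f g, Q f g = Q g f) (hB : ∀ f g, Q f (B g) = Q (B f) g)
    (hQ0 : ∀ f, 0 ≤ Q f f) (hB0 : ∀ f, 0 ≤ Q f (B f)) (v : E) :
    ∃ u : ℝ → E, u 0 = v ∧ (∀ t, HasDerivAt u (-(B (u t))) t) ∧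
      ∀ k t, 0 ≤ (-1 : ℝ) ^ k * iteratedDeriv k (fun t => Q v (u t)) t := by
  set C : E →L[ℝ] E := -B with hC
  have hexp : ∀ t : ℝ, HasDerivAt (fun u : ℝ => NormedSpace.exp (u • C))
      (C * NormedSpace.exp (t • C)) t := fun t => hasDerivAt_exp_smul_const' (𝕂 := ℝ) C t
  have hD : ∀ (P : E →L[ℝ] E) (t : ℝ), HasDerivAt (fun u : ℝ => P (NormedSpace.exp (u • C) v))
      (P (C (NormedSpace.exp (t • C) v))) t := by
    intro P t
    exact P.hasFDerivAt.comp_hasDerivAt t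
      ((ContinuousLinearMap.apply ℝ E v).hasFDerivAt.comp_hasDerivAt t (hexp t))
  have hLD : ∀ (k : ℕ) (t : ℝ), HasDerivAt (fun u : ℝ => Q v ((C ^ k) (NormedSpace.exp (u • C) v)))
      (Q v ((C ^ (k+1)) (NormedSpace.exp (t • C) v))) t := by
    intro k t
    rw [pow_succ]
    exact (Q v).hasFDerivAt.comp_hasDerivAt t (hD (C ^ k) t)
  have hiter : ∀ k, iteratedDeriv k (fun t : ℝ => Q v (NormedSpace.exp (t • C) v)) =
      fun t : ℝ => Q v ((C ^ k) (NormedSpace.exp (t • C) v)) := by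
    intro k
    induction k with
    | zero => ext t; simp
    | succ k ih =>
      rw [iteratedDeriv_succ, ih]
      ext t
      exact (hLD k t).deriv
  refine ⟨fun t => NormedSpace.exp (t • C) v, ?_, ?_, ?_⟩
  · simp
  · intro t
    exact hD (ContinuousLinearMap.id ℝ E) t
  · intro k t
    rw [hiter]
    have e1 : (-1 : ℝ) ^ k * Q v ((C ^ k) (NormedSpace.exp (t • C) v))
        = Q v ((B ^ k) (NormedSpace.exp (t • C) v)) := by
      have h : (-1 : ℝ) • C = B := by rw [hC]; simp
      have : B ^ k = (-1 : ℝ) ^ k • C ^ k := by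
        rw [← h]; exact smul_pow _ _ _
      rw [this]
      simp only [_root_.smul_apply, map_smul, smul_eq_mul]
    have e2 : t • C = (-(t/2)) • B + (-(t/2)) • B := by
      rw [hC, ← add_smul, smul_neg, ← neg_smul]; congr 1; ring
    set e := NormedSpace.exp ((-(t/2)) • B) with he
    have e3 : NormedSpace.exp (t • C) = e * e := by
      let _ : NormedAlgebra ℚ (E →L[ℝ] E) := NormedAlgebra.restrictScalars ℚ ℝ _
      rw [e2, NormedSpace.exp_add_of_commute (Commute.refl _)]
    have hcomm : ∀ n, Commute (B ^ n) e := fun n =>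
      (((Commute.refl B).smul_right (-(t/2))).exp_right).pow_left n
    have e4 : ∀ n, Q v ((B ^ n) ((e * e) v)) = Q (e v) ((B ^ n) (e v)) := by
      intro n
      have h1 : (B ^ n) ((e * e) v) = e ((B ^ n) (e v)) := by
        have := congrArg (fun T : E →L[ℝ] E => T (e v)) (hcomm n).eq
        exact this
      rw [h1]
      exact abs_exp_symm B Q hQ hB (-(t/2)) v ((B ^ n) (e v))
    show 0 ≤ (-1 : ℝ) ^ k * Q v ((C ^ k) (NormedSpace.exp (t • C) v))
    rw [e1, e3, e4]
    obtain ⟨j, hj | hj⟩ := Nat.even_or_odd' k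
    · have : (B ^ k) (e v) = (B ^ j) ((B ^ j) (e v)) := by
        rw [hj, two_mul, pow_add]; rfl
      rw [this, abs_pow_symm B Q hB]
      exact hQ0 _
    · have : (B ^ k) (e v) = (B ^ j) (B ((B ^ j) (e v))) := by
        rw [hj, two_mul, add_assoc, pow_add, pow_succ']; rfl
      rw [this, abs_pow_symm B Q hB]
      exact hB0 _

end absop

section op
open BoundedContinuousFunction

/-- Integration as a continuous functional on bounded continuous functions. -/
noncomputable def Lfun (μ : Measure ℝ) [IsFiniteMeasure μ] : (ℝ →ᵇ ℝ) →L[ℝ] ℝ :=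
  LinearMap.mkContinuous
    { toFun := fun f => ∫ x, f x ∂μ
      map_add' := fun f g => integral_add (f.integrable μ) (g.integrable μ)
      map_smul' := fun c f => by simp [integral_const_mul] }
    (μ.real univ) (fun f => by
      have := norm_integral_le_of_norm_le_const (μ := μ) (f := f) (C := ‖f‖)
        (Eventually.of_forall fun x => f.norm_coe_le_norm x)
      simpa [mul_comm] using this)

lemma Lfun_apply (μ : Measure ℝ) [IsFiniteMeasure μ] (f : ℝ →ᵇ ℝ) :
    Lfun μ f = ∫ x, f x ∂μ := rfl

/-- The clamped coordinate. -/
noncomputable def xi (N : ℝ) : ℝ →ᵇ ℝ :=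
  BoundedContinuousFunction.ofNormedAddCommGroup (fun x => max (-|N|) (min x |N|)) (by fun_prop) |N|
    (fun x => by
      rw [Real.norm_eq_abs, abs_le]
      exact ⟨le_max_left _ _, max_le (by linarith [abs_nonneg N]) (min_le_right _ _)⟩)

lemma xi_apply (N x : ℝ) (h0 : 0 < x) (h1 : x ≤ N) : xi N x = x := by
  have : |N| = N := abs_of_pos (by linarith)
  simp only [xi, BoundedContinuousFunction.coe_ofNormedAddCommGroup, this]
  rw [min_eq_left h1, max_eq_right (by linarith)]

/-- the rank one perturbation -/
noncomputable def Bop (μ : Measure ℝ) [IsFiniteMeasure μ] (N : ℝ) : (ℝ →ᵇ ℝ) →L[ℝ] (ℝ →ᵇ ℝ) :=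
  ContinuousLinearMap.mul ℝ (ℝ →ᵇ ℝ) (xi N) - (Lfun μ).smulRight 1

lemma Bop_apply (μ : Measure ℝ) [IsFiniteMeasure μ] (N : ℝ) (f : ℝ →ᵇ ℝ) :
    Bop μ N f = xi N * f - Lfun μ f • 1 := by
  simp [Bop]

lemma Bop_symm (μ : Measure ℝ) [IsFiniteMeasure μ] (N : ℝ) (f g : ℝ →ᵇ ℝ) :
    Lfun μ (f * Bop μ N g) = Lfun μ (Bop μ N f * g) := by
  simp only [Bop_apply, mul_sub, sub_mul, map_sub, mul_smul_comm, smul_mul_assoc, map_smul, mul_one,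
    one_mul, smul_eq_mul]
  rw [mul_comm (Lfun μ f), mul_left_comm f, mul_assoc]

lemma Bop_nonneg (μ : Measure ℝ) [IsFiniteMeasure μ] (N : ℝ) (hpos : ∀ᵐ x ∂μ, 0 < x)
    (hN : ∀ᵐ x ∂μ, x ≤ N) (hi : Integrable (fun x : ℝ => x⁻¹) μ) (h1 : ∫ x, x⁻¹ ∂μ ≤ 1)
    (f : ℝ →ᵇ ℝ) : 0 ≤ Lfun μ (f * Bop μ N f) := by
  set c := Lfun μ f with hc
  have e : Lfun μ (f * Bop μ N f) = Lfun μ (f * (xi N * f)) - c * c := by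
    simp only [Bop_apply, mul_sub, map_sub, mul_smul_comm, map_smul, mul_one, smul_eq_mul, ← hc]
  have i1 : Integrable (fun x => (f * (xi N * f)) x) μ := BoundedContinuousFunction.integrable μ _
  have i2 : Integrable (fun x => f x) μ := BoundedContinuousFunction.integrable μ _
  have h : 0 ≤ ∫ x, ((f * (xi N * f)) x - 2 * c * f x + c ^ 2 * x⁻¹) ∂μ := by
    apply integral_nonneg_of_ae
    filter_upwards [hpos, hN] with x hx hxN
    simp only [BoundedContinuousFunction.mul_apply, xi_apply N x hx hxN, Pi.zero_apply]
    have : f x * (x * f x) - 2 * c * f x + c ^ 2 * x⁻¹ = (x * f x - c) ^ 2 * x⁻¹ := by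
      field_simp; ring
    rw [this]; positivity
  have i3 : Integrable (fun x => (f * (xi N * f)) x - 2 * c * f x) μ := i1.sub (i2.const_mul _)
  rw [integral_add i3 (hi.const_mul _), integral_sub i1 (i2.const_mul _),
    integral_const_mul, integral_const_mul, ← Lfun_apply, ← Lfun_apply, ← hc] at h
  rw [e]
  nlinarith [sq_nonneg c]

lemma op_exists (μ : Measure ℝ) [IsFiniteMeasure μ] (N : ℝ) (hpos : ∀ᵐ x ∂μ, 0 < x)
    (hN : ∀ᵐ x ∂μ, x ≤ N) (hi : Integrable (fun x : ℝ => x⁻¹) μ) (h1 : ∫ x, x⁻¹ ∂μ ≤ 1) :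
    ∃ r : ℝ → ℝ, Continuous r ∧ (∀ t, r t = ∫ x, U r t x ∂μ) ∧
      ∀ k t, 0 ≤ (-1 : ℝ) ^ k * iteratedDeriv k r t := by
  obtain ⟨u, hu0, hu, hk⟩ := abs_op (Bop μ N)
    (fun f => (Lfun μ).comp (ContinuousLinearMap.mul ℝ (ℝ →ᵇ ℝ) f))
    (fun f g => by simp [mul_comm]) (fun f g => by simpa using Bop_symm μ N f g)
    (fun f => integral_nonneg fun x => mul_self_nonneg (f x))
    (fun f => Bop_nonneg μ N hpos hN hi h1 f) 1
  set r : ℝ → ℝ := fun t => Lfun μ (u t) with hr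
  have hr' : (fun t => ((Lfun μ).comp (ContinuousLinearMap.mul ℝ (ℝ →ᵇ ℝ) 1)) (u t)) = r := by
    ext t; simp [hr]
  rw [hr'] at hk
  have hrc : Continuous r := (Lfun μ).continuous.comp
    (continuous_iff_continuousAt.2 fun t => (hu t).continuousAt)
  refine ⟨r, hrc, ?_, hk⟩
  intro t
  rw [hr]
  simp only [Lfun_apply]
  apply integral_congr_ae
  filter_upwards [hpos, hN] with x hx hxN
  refine eq_U r (fun t => u t x) hrc x ?_ (by simp [hu0]) t
  intro s
  have h3 := (BoundedContinuousFunction.evalCLM ℝ x).hasFDerivAt.comp_hasDerivAt s (hu s)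
  refine h3.congr_deriv ?_
  simp [Bop_apply, xi_apply N x hx hxN, hr]
  ring

end op

lemma int_bound (R : ℝ → ℝ) (T C : ℝ) (hC : ∀ s, 0 ≤ s → s ≤ T → |R s| ≤ C)
    (x t : ℝ) (hx : 0 ≤ x) (ht : 0 ≤ t) (htT : t ≤ T) :
    |∫ s in (0:ℝ)..t, exp (-(x * (t - s))) * R s| ≤ C * T := by
  have hC0 : 0 ≤ C := (abs_nonneg _).trans (hC 0 le_rfl (ht.trans htT))
  have h2 : ‖∫ s in (0:ℝ)..t, exp (-(x * (t - s))) * R s‖ ≤ C * |t - 0| := by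
    apply intervalIntegral.norm_integral_le_of_norm_le_const
    intro s hs
    rw [uIoc_of_le ht] at hs
    rw [Real.norm_eq_abs, abs_mul, abs_of_pos (Real.exp_pos _)]
    have h3 : exp (-(x * (t - s))) ≤ 1 := by
      rw [Real.exp_le_one_iff]; nlinarith [hs.2]
    calc _ ≤ 1 * C := by
          apply mul_le_mul h3 (hC s hs.1.le (hs.2.trans htT)) (abs_nonneg _) zero_le_one
      _ = C := one_mul C
  rw [Real.norm_eq_abs, sub_zero, abs_of_nonneg ht] at h2
  nlinarith

lemma U_bound (R : ℝ → ℝ) (T C : ℝ) (hC : ∀ s, 0 ≤ s → s ≤ T → |R s| ≤ C)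
    (x t : ℝ) (hx : 0 ≤ x) (ht : 0 ≤ t) (htT : t ≤ T) : |U R t x| ≤ 1 + C * T := by
  have h1 : |exp (-(x * t))| ≤ 1 := by
    rw [abs_of_pos (Real.exp_pos _), Real.exp_le_one_iff]; nlinarith
  exact (abs_add_le _ _).trans (add_le_add h1 (int_bound R T C hC x t hx ht htT))

lemma bdd_of_cont (R : ℝ → ℝ) (hR : Continuous R) (T : ℝ) :
    ∃ C, 0 ≤ C ∧ ∀ s, 0 ≤ s → s ≤ T → |R s| ≤ C := by
  obtain ⟨C, hC⟩ := (isCompact_Icc (a := (0:ℝ)) (b := T)).exists_bound_of_continuousOn hR.continuousOn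
  exact ⟨max C 0, le_max_right _ _, fun s h0 h1 => (hC s ⟨h0, h1⟩).trans (le_max_left _ _)⟩

noncomputable def G (μ : Measure ℝ) (R : ℝ → ℝ) (k : ℕ) (t : ℝ) : ℝ :=
  ∫ x, (-x) ^ k * U R t x ∂μ

noncomputable def mom (μ : Measure ℝ) (k : ℕ) : ℝ := ∫ x, (-x) ^ k ∂μ

lemma mom_int (μ : Measure ℝ) (hm : ∀ k : ℕ, Integrable (fun x : ℝ => x ^ k) μ) (k : ℕ) :
    Integrable (fun x : ℝ => (-x) ^ k) μ := by
  have : (fun x : ℝ => (-x) ^ k) = fun x => (-1) ^ k * x ^ k := by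
    ext x; rw [← mul_pow]; simp
  rw [this]
  exact (hm k).const_mul _

lemma G_integrable (μ : Measure ℝ) (hpos : ∀ᵐ x ∂μ, 0 < x)
    (hm : ∀ k : ℕ, Integrable (fun x : ℝ => x ^ k) μ) (R : ℝ → ℝ) (hR : Continuous R)
    (k : ℕ) (t : ℝ) (ht : 0 ≤ t) : Integrable (fun x => (-x) ^ k * U R t x) μ := by
  obtain ⟨C, hC0, hC⟩ := bdd_of_cont R hR t
  refine ((hm k).mul_const (1 + C * t)).mono'
    (((by fun_prop : Continuous fun x : ℝ => (-x) ^ k).mul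
      (U_continuous R hR t)).aestronglyMeasurable) ?_
  filter_upwards [hpos] with x hx
  rw [norm_mul, norm_pow, norm_neg, Real.norm_eq_abs, Real.norm_eq_abs, abs_of_pos hx]
  exact mul_le_mul_of_nonneg_left (U_bound R t C hC x t hx.le ht le_rfl) (by positivity)

lemma G_hasDerivAt (μ : Measure ℝ) (hpos : ∀ᵐ x ∂μ, 0 < x)
    (hm : ∀ k : ℕ, Integrable (fun x : ℝ => x ^ k) μ) (R : ℝ → ℝ) (hR : Continuous R)
    (k : ℕ) (t : ℝ) (ht : 0 < t) :
    HasDerivAt (G μ R k) (G μ R (k+1) t + mom μ k * R t) t := by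
  obtain ⟨C, hC0, hC⟩ := bdd_of_cont R hR (t + 1)
  have key := hasDerivAt_integral_of_dominated_loc_of_deriv_le (μ := μ) (𝕜 := ℝ)
    (F := fun t x => (-x) ^ k * U R t x) (x₀ := t) (s := Ioo 0 (t + 1))
    (bound := fun x => x ^ (k+1) * (1 + C * (t+1)) + x ^ k * C)
    (F' := fun t x => (-x) ^ k * (-x * U R t x + R t))
    (Ioo_mem_nhds ht (by linarith))
    (Eventually.of_forall fun s => ((by fun_prop : Continuous fun x : ℝ => (-x) ^ k).mul
      (U_continuous R hR s)).aestronglyMeasurable)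
    (G_integrable μ hpos hm R hR k t ht.le)
    (by
      have := U_continuous R hR t
      exact Continuous.aestronglyMeasurable (by fun_prop))
    (by
      filter_upwards [hpos] with x hx s hs
      have hU := U_bound R (t+1) C hC x s hx.le hs.1.le hs.2.le
      have hRs := hC s hs.1.le hs.2.le
      rw [norm_mul, norm_pow, norm_neg, Real.norm_eq_abs, Real.norm_eq_abs, abs_of_pos hx]
      have h1 : |-x * U R s x + R s| ≤ x * (1 + C * (t+1)) + C := by
        refine (abs_add_le _ _).trans (add_le_add ?_ hRs)
        rw [abs_mul, abs_neg, abs_of_pos hx]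
        exact mul_le_mul_of_nonneg_left hU hx.le
      calc _ ≤ x ^ k * (x * (1 + C * (t+1)) + C) := mul_le_mul_of_nonneg_left h1 (by positivity)
        _ = _ := by ring)
    (((hm (k+1)).mul_const _).add ((hm k).mul_const _))
    (Eventually.of_forall fun x s _ => (U_hasDerivAt R hR s x).const_mul _)
  refine key.2.congr_deriv ?_
  have e : (fun x => (-x) ^ k * (-x * U R t x + R t)) =
      fun x => (-x) ^ (k+1) * U R t x + (-x) ^ k * R t := by
    ext x; ring
  rw [e, integral_add (G_integrable μ hpos hm R hR (k+1) t ht.le) ((mom_int μ hm k).mul_const _),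
    integral_mul_const]
  rfl

/-- The formal derivation acting on the sequences `G`. -/
def Tr (a : ℕ → ℝ) (g : ℕ → ℝ) : ℕ → ℝ := fun k => g (k + 1) + a k * g 0

lemma Tr_hasDerivAt (μ : Measure ℝ) (hpos : ∀ᵐ x ∂μ, 0 < x)
    (hm : ∀ k : ℕ, Integrable (fun x : ℝ => x ^ k) μ) (R : ℝ → ℝ) (hR : Continuous R)
    (hsol : ∀ t, 0 ≤ t → R t = G μ R 0 t) (n : ℕ) : ∀ (k : ℕ) (t : ℝ) (_ : 0 < t),
    HasDerivAt (fun t => (Tr (mom μ))^[n] (fun k => G μ R k t) k)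
      ((Tr (mom μ))^[n+1] (fun k => G μ R k t) k) t := by
  induction n with
  | zero =>
    intro k t ht
    have := G_hasDerivAt μ hpos hm R hR k t ht
    rw [hsol t ht.le] at this
    exact this
  | succ n ih =>
    intro k t ht
    have := (ih (k+1) t ht).add ((ih 0 t ht).const_mul (mom μ k))
    simp only [Function.iterate_succ_apply'] at this ⊢
    exact this

lemma iteratedDeriv_eq (μ : Measure ℝ) (hpos : ∀ᵐ x ∂μ, 0 < x)
    (hm : ∀ k : ℕ, Integrable (fun x : ℝ => x ^ k) μ) (R : ℝ → ℝ) (hR : Continuous R)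
    (hsol : ∀ t, 0 ≤ t → R t = G μ R 0 t) (n : ℕ) : ∀ (t : ℝ) (_ : 0 < t),
    iteratedDeriv n R t = (Tr (mom μ))^[n] (fun k => G μ R k t) 0 := by
  induction n with
  | zero => intro t ht; simpa using hsol t ht.le
  | succ n ih =>
    intro t ht
    rw [iteratedDeriv_succ]
    have : iteratedDeriv n R =ᶠ[nhds t] fun t => (Tr (mom μ))^[n] (fun k => G μ R k t) 0 := by
      filter_upwards [Ioi_mem_nhds ht] with s hs using ih s hs
    rw [this.deriv_eq]
    exact (Tr_hasDerivAt μ hpos hm R hR hsol n 0 t ht).deriv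

lemma contDiffAt_R (μ : Measure ℝ) (hpos : ∀ᵐ x ∂μ, 0 < x)
    (hm : ∀ k : ℕ, Integrable (fun x : ℝ => x ^ k) μ) (R : ℝ → ℝ) (hR : Continuous R)
    (hsol : ∀ t, 0 ≤ t → R t = G μ R 0 t) (t : ℝ) (ht : 0 < t) :
    ContDiffAt ℝ (⊤ : ℕ∞) R t := by
  have : ContDiffOn ℝ (⊤ : ℕ∞) R (Ioi 0) := by
    apply contDiffOn_of_differentiableOn_deriv
    intro m _ s hs
    have hs' : 0 < s := hs
    have h1 : DifferentiableAt ℝ (fun t => (Tr (mom μ))^[m] (fun k => G μ R k t) 0) s :=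
      (Tr_hasDerivAt μ hpos hm R hR hsol m 0 s hs').differentiableAt
    refine h1.differentiableWithinAt.congr (fun y hy => ?_) ?_
    · rw [iteratedDerivWithin_of_isOpen isOpen_Ioi hy]
      exact iteratedDeriv_eq μ hpos hm R hR hsol m y hy
    · rw [iteratedDerivWithin_of_isOpen isOpen_Ioi hs]
      exact iteratedDeriv_eq μ hpos hm R hR hsol m s hs
  exact this.contDiffAt (Ioi_mem_nhds ht)

lemma Tr_tendsto (aN : ℕ → ℕ → ℝ) (a : ℕ → ℝ) (gN : ℕ → ℕ → ℝ) (g : ℕ → ℝ)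
    (ha : ∀ k, Tendsto (fun N => aN N k) atTop (nhds (a k)))
    (hg : ∀ k, Tendsto (fun N => gN N k) atTop (nhds (g k))) (n : ℕ) : ∀ k,
    Tendsto (fun N => (Tr (aN N))^[n] (gN N) k) atTop (nhds ((Tr a)^[n] g k)) := by
  induction n with
  | zero => exact hg
  | succ n ih =>
    intro k
    simp only [Function.iterate_succ_apply']
    exact (ih (k+1)).add ((ha k).mul (ih 0))

/-- Comparison of `R` with the truncated solution. -/
lemma compare (μ : Measure ℝ) [IsFiniteMeasure μ] (hpos : ∀ᵐ x ∂μ, 0 < x)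
    (hm : ∀ k : ℕ, Integrable (fun x : ℝ => x ^ k) μ) (R : ℝ → ℝ) (hR : Continuous R)
    (hsol : ∀ t, 0 ≤ t → R t = G μ R 0 t) (N : ℝ) (r : ℝ → ℝ) (hr : Continuous r)
    (hrsol : ∀ t, r t = ∫ x, U r t x ∂(μ.restrict (Iic N)))
    (T C : ℝ) (hC : ∀ s, 0 ≤ s → s ≤ T → |R s| ≤ C) (t : ℝ) (ht : 0 ≤ t) (htT : t ≤ T) :
    |R t - r t| ≤ gronwallBound 0 (μ.real univ) ((1 + C * T) * μ.real (Ioi N)) t * μ.real univ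
      + (1 + C * T) * μ.real (Ioi N) := by
  set M := μ.real univ with hM
  set ε := (1 + C * T) * μ.real (Ioi N) with hε
  have hcont : Continuous (fun s => |R s - r s|) := by fun_prop
  have hposN : ∀ᵐ x ∂(μ.restrict (Iic N)), 0 < x := ae_restrict_of_ae hpos
  have hmN : ∀ k : ℕ, Integrable (fun x : ℝ => x ^ k) (μ.restrict (Iic N)) :=
    fun k => (hm k).restrict
  -- pointwise inequality
  have hineq : ∀ t, 0 ≤ t → t ≤ T →
      |R t - r t| ≤ M * (∫ s in (0:ℝ)..t, |R s - r s|) + ε := by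
    intro t ht htT
    have iR : Integrable (fun x => U R t x) μ := by
      simpa using G_integrable μ hpos hm R hR 0 t ht
    have ir : Integrable (fun x => U r t x) (μ.restrict (Iic N)) := by
      simpa using G_integrable _ hposN hmN r hr 0 t ht
    have e1 : R t = ∫ x in Iic N, U R t x ∂μ + ∫ x in Ioi N, U R t x ∂μ := by
      rw [hsol t ht, ← compl_Iic, integral_add_compl measurableSet_Iic iR]
      simp [G]
    have e2 : R t - r t = ∫ x in Iic N, (U R t x - U r t x) ∂μ + ∫ x in Ioi N, U R t x ∂μ := by
      rw [integral_sub iR.restrict ir, ← hrsol t, e1]; ring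
    have hF0 : 0 ≤ ∫ s in (0:ℝ)..t, |R s - r s| :=
      intervalIntegral.integral_nonneg ht fun s _ => abs_nonneg _
    have b1 : |∫ x in Iic N, (U R t x - U r t x) ∂μ| ≤ M * (∫ s in (0:ℝ)..t, |R s - r s|) := by
      have := norm_integral_le_of_norm_le_const (μ := μ.restrict (Iic N))
        (f := fun x => U R t x - U r t x) (C := ∫ s in (0:ℝ)..t, |R s - r s|) (by
          filter_upwards [hposN] with x hx
          have cR : Continuous (fun s => exp (-(x * (t - s))) * R s) := by fun_prop
          have cr : Continuous (fun s => exp (-(x * (t - s))) * r s) := by fun_prop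
          have : U R t x - U r t x = ∫ s in (0:ℝ)..t, exp (-(x * (t - s))) * (R s - r s) := by
            have e : (fun s => exp (-(x * (t - s))) * (R s - r s)) = fun s =>
                exp (-(x * (t - s))) * R s - exp (-(x * (t - s))) * r s := by
              ext s; ring
            rw [e, intervalIntegral.integral_sub (cR.intervalIntegrable _ _) (cr.intervalIntegrable _ _)]
            unfold U; ring
          rw [this]
          apply intervalIntegral.norm_integral_le_of_norm_le ht _ (hcont.intervalIntegrable _ _)
          refine Eventually.of_forall fun s hs => ?_
          rw [Real.norm_eq_abs, abs_mul, abs_of_pos (Real.exp_pos _)]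
          have h3 : exp (-(x * (t - s))) ≤ 1 := by
            rw [Real.exp_le_one_iff]; nlinarith [hs.2]
          exact mul_le_of_le_one_left (abs_nonneg _) h3)
      rw [Real.norm_eq_abs] at this
      refine this.trans ?_
      rw [mul_comm M]
      apply mul_le_mul_of_nonneg_left _ hF0
      rw [hM, measureReal_restrict_apply_univ]
      exact measureReal_mono (subset_univ _)
    have b2 : |∫ x in Ioi N, U R t x ∂μ| ≤ ε := by
      have := norm_integral_le_of_norm_le_const (μ := μ.restrict (Ioi N))
        (f := fun x => U R t x) (C := 1 + C * T) (by
          filter_upwards [ae_restrict_of_ae hpos] with x hx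
          exact U_bound R T C hC x t hx.le ht htT)
      rwa [Real.norm_eq_abs, measureReal_restrict_apply_univ] at this
    rw [e2]
    exact (abs_add_le _ _).trans (add_le_add b1 b2)
  set F : ℝ → ℝ := fun t => ∫ s in (0:ℝ)..t, |R s - r s| with hF
  have hFd : ∀ t, HasDerivAt F |R t - r t| t := fun t =>
    intervalIntegral.integral_hasDerivAt_right (hcont.intervalIntegrable _ _)
      (hcont.stronglyMeasurableAtFilter _ _) hcont.continuousAt
  have hFn : ∀ t, 0 ≤ t → 0 ≤ F t := fun t ht =>
    intervalIntegral.integral_nonneg ht fun s _ => abs_nonneg _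
  have hgr := norm_le_gronwallBound_of_norm_deriv_right_le (f := F) (f' := fun t => |R t - r t|)
    (δ := 0) (K := M) (ε := ε) (a := 0) (b := T)
    (fun s _ => (hFd s).continuousAt.continuousWithinAt)
    (fun s _ => (hFd s).hasDerivWithinAt) (by simp [hF])
    (fun s hs => by
      rw [Real.norm_eq_abs, abs_abs, Real.norm_eq_abs, abs_of_nonneg (hFn s hs.1)]
      exact hineq s hs.1 hs.2.le) t ⟨ht, htT⟩
  rw [Real.norm_eq_abs, abs_of_nonneg (hFn t ht), sub_zero] at hgr
  have hM0 : 0 ≤ M := measureReal_nonneg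
  have := hineq t ht htT
  nlinarith

lemma main_abs (μ : Measure ℝ) [IsFiniteMeasure μ] (hpos : ∀ᵐ x ∂μ, 0 < x)
    (hm : ∀ k : ℕ, Integrable (fun x : ℝ => x ^ k) μ)
    (hi : Integrable (fun x : ℝ => x⁻¹) μ) (h1 : ∫ x, x⁻¹ ∂μ ≤ 1) (R : ℝ → ℝ) (hR : Continuous R)
    (hsol : ∀ t, 0 ≤ t → R t = G μ R 0 t) (k : ℕ) (t : ℝ) (ht : 0 < t) :
    0 ≤ (-1 : ℝ) ^ k * iteratedDeriv k R t := by
  have hposN : ∀ N : ℕ, ∀ᵐ x ∂(μ.restrict (Iic (N:ℝ))), 0 < x := fun N => ae_restrict_of_ae hpos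
  have hmN : ∀ N : ℕ, ∀ k : ℕ, Integrable (fun x : ℝ => x ^ k) (μ.restrict (Iic (N:ℝ))) :=
    fun N k => (hm k).restrict
  have hex : ∀ N : ℕ, ∃ r : ℝ → ℝ, Continuous r ∧
      (∀ t, r t = ∫ x, U r t x ∂(μ.restrict (Iic (N:ℝ)))) ∧
      ∀ k t, 0 ≤ (-1 : ℝ) ^ k * iteratedDeriv k r t := fun N => by
    apply op_exists (μ.restrict (Iic (N:ℝ))) N (hposN N) (ae_restrict_mem measurableSet_Iic)
      hi.restrict
    refine (setIntegral_le_integral hi ?_).trans h1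
    filter_upwards [hpos] with x hx
    exact (inv_pos.2 hx).le
  choose r hrc hrsol hrk using hex
  obtain ⟨C, hC0, hC⟩ := bdd_of_cont R hR t
  have hμ : Tendsto (fun N : ℕ => μ.real (Ioi (N:ℝ))) atTop (nhds 0) := by
    have h := tendsto_measure_iInter_atTop (μ := μ) (s := fun N : ℕ => Ioi (N:ℝ))
      (fun _ => measurableSet_Ioi.nullMeasurableSet)
      (fun a b hab => Ioi_subset_Ioi (by exact_mod_cast hab)) ⟨0, measure_ne_top _ _⟩
    have hempty : (⋂ N : ℕ, Ioi (N:ℝ)) = ∅ := by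
      ext x
      simp only [mem_iInter, mem_Ioi, mem_empty_iff_false, iff_false, not_forall, not_lt]
      exact exists_nat_ge x
    rw [hempty, measure_empty] at h
    exact (ENNReal.tendsto_toReal ENNReal.zero_ne_top).comp h
  have hbd : ∀ s, 0 ≤ s → Tendsto (fun N : ℕ =>
      gronwallBound 0 (μ.real univ) ((1 + C * t) * μ.real (Ioi (N:ℝ))) s * μ.real univ
      + (1 + C * t) * μ.real (Ioi (N:ℝ))) atTop (nhds 0) := by
    intro s hs
    have h2 : Tendsto (fun N : ℕ => (1 + C * t) * μ.real (Ioi (N:ℝ))) atTop (nhds 0) := by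
      simpa using hμ.const_mul (1 + C * t)
    have h3 := ((gronwallBound_continuous_ε 0 (μ.real univ) s).tendsto 0).comp h2
    rw [gronwallBound_ε0_δ0] at h3
    simpa using (h3.mul_const (μ.real univ)).add h2
  have hconv : ∀ s, 0 ≤ s → s ≤ t → Tendsto (fun N => r N s) atTop (nhds (R s)) := by
    intro s hs hst
    have h0 : Tendsto (fun N => R s - r N s) atTop (nhds 0) :=
      squeeze_zero_norm (fun N => compare μ hpos hm R hR hsol N (r N) (hrc N) (hrsol N) t C hC s hs hst)
        (hbd s hs)
    simpa using tendsto_const_nhds (x := R s).sub h0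
  -- uniform bound
  obtain ⟨C', hC'⟩ : ∃ C', ∀ N s, 0 ≤ s → s ≤ t → |r N s| ≤ C' := by
    refine ⟨C + (gronwallBound 0 (μ.real univ) ((1 + C * t) * μ.real univ) t * μ.real univ
      + (1 + C * t) * μ.real univ), fun N s hs hst => ?_⟩
    have h2 := compare μ hpos hm R hR hsol N (r N) (hrc N) (hrsol N) t C hC s hs hst
    have h3 : |r N s| ≤ |R s| + |R s - r N s| := by
      have := abs_sub (R s) (R s - r N s)
      simpa using this
    have hle : (1 + C * t) * μ.real (Ioi (N:ℝ)) ≤ (1 + C * t) * μ.real univ :=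
      mul_le_mul_of_nonneg_left (measureReal_mono (subset_univ _)) (by positivity)
    have h4 : gronwallBound 0 (μ.real univ) ((1 + C * t) * μ.real (Ioi (N:ℝ))) s ≤
        gronwallBound 0 (μ.real univ) ((1 + C * t) * μ.real univ) t := by
      have hC1 : 0 ≤ 1 + C * t := by positivity
      rcases eq_or_ne (μ.real univ) 0 with h | h
      · rw [h, gronwallBound_K0, gronwallBound_K0]
        rw [h] at hle
        have : 0 ≤ μ.real (Ioi (N:ℝ)) := measureReal_nonneg
        have h5 : (1 + C * t) * μ.real (Ioi (N:ℝ)) = 0 := le_antisymm (by simpa using hle) (by positivity)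
        simp [h5]
      · have hM : 0 < μ.real univ := lt_of_le_of_ne measureReal_nonneg (Ne.symm h)
        rw [gronwallBound_of_K_ne_0 h, gronwallBound_of_K_ne_0 h]
        simp only [zero_mul, zero_add]
        have h6 : exp (μ.real univ * s) ≤ exp (μ.real univ * t) := by gcongr
        have h7 : 1 ≤ exp (μ.real univ * s) := Real.one_le_exp (by positivity)
        apply mul_le_mul
        · gcongr
        · linarith
        · linarith
        · positivity
    have h5 := mul_le_mul_of_nonneg_right h4 (measureReal_nonneg (μ := μ) (s := univ))
    linarith [hC s hs hst]
  have hU : ∀ x, 0 < x → Tendsto (fun N => U (r N) t x) atTop (nhds (U R t x)) := by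
    intro x hx
    unfold U
    refine tendsto_const_nhds.add ?_
    apply intervalIntegral.tendsto_integral_filter_of_dominated_convergence (fun _ => C')
    · refine Eventually.of_forall fun N => ?_
      have := hrc N
      exact Continuous.aestronglyMeasurable (by fun_prop)
    · refine Eventually.of_forall fun N => Eventually.of_forall fun s hs => ?_
      rw [uIoc_of_le ht.le] at hs
      rw [Real.norm_eq_abs, abs_mul, abs_of_pos (Real.exp_pos _)]
      have h3 : exp (-(x * (t - s))) ≤ 1 := by
        rw [Real.exp_le_one_iff]; nlinarith [hs.2]
      exact (mul_le_of_le_one_left (abs_nonneg _) h3).trans (hC' N s hs.1.le hs.2)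
    · exact intervalIntegrable_const
    · refine Eventually.of_forall fun s hs => ?_
      rw [uIoc_of_le ht.le] at hs
      exact (hconv s hs.1.le hs.2).const_mul _
  have hind : ∀ (f : ℕ → ℝ → ℝ) (g : ℝ → ℝ) (x : ℝ), Tendsto (fun N => f N x) atTop (nhds (g x)) →
      Tendsto (fun N : ℕ => (Iic (N:ℝ)).indicator (f N) x) atTop (nhds (g x)) := by
    intro f g x h
    refine h.congr' ?_
    filter_upwards [eventually_ge_atTop ⌈x⌉₊] with N hN
    rw [indicator_of_mem]
    exact (Nat.le_ceil x).trans (by exact_mod_cast hN)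
  have ha : ∀ k, Tendsto (fun N : ℕ => mom (μ.restrict (Iic (N:ℝ))) k) atTop (nhds (mom μ k)) := by
    intro k
    unfold mom
    simp only [← integral_indicator (measurableSet_Iic)]
    apply tendsto_integral_of_dominated_convergence (fun x => |(-x) ^ k|)
    · intro N
      exact ((mom_int μ hm k).indicator measurableSet_Iic).aestronglyMeasurable
    · exact (mom_int μ hm k).abs
    · intro N
      exact Eventually.of_forall fun x => norm_indicator_le_norm_self _ _
    · exact Eventually.of_forall fun x => hind (fun _ x => (-x) ^ k) (fun x => (-x) ^ k) x tendsto_const_nhds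
  have hg : ∀ k, Tendsto (fun N : ℕ => G (μ.restrict (Iic (N:ℝ))) (r N) k t) atTop
      (nhds (G μ R k t)) := by
    intro k
    unfold G
    simp only [← integral_indicator (measurableSet_Iic)]
    apply tendsto_integral_of_dominated_convergence (fun x => x ^ k * (1 + C' * t))
    · intro N
      exact ((G_integrable μ hpos hm (r N) (hrc N) k t ht.le).indicator
        measurableSet_Iic).aestronglyMeasurable
    · exact (hm k).mul_const _
    · intro N
      filter_upwards [hpos] with x hx
      refine (norm_indicator_le_norm_self _ _).trans ?_
      rw [norm_mul, norm_pow, norm_neg, Real.norm_eq_abs, Real.norm_eq_abs, abs_of_pos hx]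
      exact mul_le_mul_of_nonneg_left (U_bound (r N) t C' (hC' N) x t hx.le ht.le le_rfl)
        (by positivity)
    · filter_upwards [hpos] with x hx
      exact hind (fun N x => (-x) ^ k * U (r N) t x) (fun x => (-x) ^ k * U R t x) x
        ((hU x hx).const_mul _)
  have hT := Tr_tendsto (fun N => mom (μ.restrict (Iic (N:ℝ)))) (mom μ)
    (fun N k => G (μ.restrict (Iic (N:ℝ))) (r N) k t) (fun k => G μ R k t) ha hg k 0
  rw [iteratedDeriv_eq μ hpos hm R hR hsol k t ht]
  refine ge_of_tendsto' (hT.const_mul ((-1 : ℝ) ^ k)) fun N => ?_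
  rw [← iteratedDeriv_eq (μ.restrict (Iic (N:ℝ))) (hposN N) (hmN N) (r N) (hrc N)
    (fun s _ => by simpa [G] using hrsol N s) k t ht]
  exact hrk N k t

section series

lemma convPow_congr (φ ψ : ℝ → ℝ) (h : ∀ t, 0 ≤ t → φ t = ψ t) (k : ℕ) : ∀ t, 0 ≤ t →
    convPow φ k t = convPow ψ k t := by
  induction k with
  | zero => exact h
  | succ k ih =>
    intro t ht
    simp only [convPow, conv]
    apply intervalIntegral.integral_congr
    intro s hs
    rw [uIcc_of_le ht] at hs
    simp only
    rw [h (t - s) (by linarith [hs.2]), ih s hs.1]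

lemma convPow_cont (ψ : ℝ → ℝ) (hψ : Continuous ψ) (k : ℕ) : Continuous (convPow ψ k) := by
  induction k with
  | zero => exact hψ
  | succ k ih =>
    exact intervalIntegral.continuous_parametric_intervalIntegral_of_continuous
      (f := fun t s => ψ (t - s) * convPow ψ k s) (by fun_prop) continuous_id

lemma convPow_bound (ψ : ℝ → ℝ) (M : ℝ) (hM : ∀ t, 0 ≤ t → |ψ t| ≤ M) (k : ℕ) : ∀ t, 0 ≤ t →
    |convPow ψ k t| ≤ M * ((M * t) ^ k / k.factorial) := by
  have hM0 : 0 ≤ M := (abs_nonneg _).trans (hM 0 le_rfl)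
  induction k with
  | zero => intro t ht; simpa [convPow] using hM t ht
  | succ k ih =>
    intro t ht
    have h1 : ‖convPow ψ (k+1) t‖ ≤ ∫ s in (0:ℝ)..t, M * (M * ((M * s) ^ k / k.factorial)) := by
      apply intervalIntegral.norm_integral_le_of_norm_le ht
      · refine Eventually.of_forall fun s hs => ?_
        rw [norm_mul]
        exact mul_le_mul (hM _ (by linarith [hs.2])) (ih s hs.1.le) (abs_nonneg _) hM0
      · exact Continuous.intervalIntegrable (by fun_prop) _ _
    refine h1.trans (le_of_eq ?_)
    have e : (fun s : ℝ => M * (M * ((M * s) ^ k / k.factorial))) =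
        fun s => (M * (M * (M ^ k / k.factorial))) * s ^ k := by
      ext s; rw [mul_pow]; ring
    rw [e, intervalIntegral.integral_const_mul, integral_pow, Nat.factorial_succ]
    push_cast
    field_simp
    ring

lemma series_sol (ψ : ℝ → ℝ) (hψ : Continuous ψ) (M : ℝ)
    (hM : ∀ t, 0 ≤ t → |ψ t| ≤ M) : ∃ R : ℝ → ℝ, Continuous R ∧ (∀ t, 0 ≤ t → R t = ∑' k, convPow ψ k t) ∧
    ∀ t, 0 ≤ t → R t = ψ t + ∫ s in (0:ℝ)..t, ψ (t - s) * R s := by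
  have hM0 : 0 ≤ M := (abs_nonneg _).trans (hM 0 le_rfl)
  have hsum : ∀ T : ℝ, Summable (fun k : ℕ => M * ((M * T) ^ k / k.factorial)) := fun T =>
    (Real.summable_pow_div_factorial (M * T)).mul_left M
  have hb : ∀ (k : ℕ) (s T : ℝ), 0 ≤ s → s ≤ T →
      ‖convPow ψ k s‖ ≤ M * ((M * T) ^ k / k.factorial) := by
    intro k s T hs hsT
    refine (convPow_bound ψ M hM k s hs).trans ?_
    gcongr
  have hS : ∀ t, 0 ≤ t → Summable (fun k => convPow ψ k t) := fun t ht =>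
    Summable.of_norm_bounded (hsum t) fun k => hb k t t ht le_rfl
  refine ⟨fun t => ∑' k, convPow ψ k (max t 0), ?_, ?_, ?_⟩
  · rw [continuous_iff_continuousAt]
    intro t
    have : ContinuousOn (fun t => ∑' k, convPow ψ k (max t 0)) (Iio (|t| + 1)) := by
      apply continuousOn_tsum (u := fun k : ℕ => M * ((M * (|t| + 1)) ^ k / k.factorial))
      · intro k
        have := convPow_cont ψ hψ k
        exact Continuous.continuousOn (by fun_prop)
      · exact hsum _
      · intro k s hs
        exact hb k _ _ (le_max_right _ _) (max_le (le_of_lt hs) (by positivity))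
    exact this.continuousAt (Iio_mem_nhds (by linarith [le_abs_self t]))
  · intro t ht
    simp [max_eq_left ht]
  · intro t ht
    simp only [max_eq_left ht]
    rw [(hS t ht).tsum_eq_zero_add]
    congr 1
    have := intervalIntegral.hasSum_integral_of_dominated_convergence (μ := volume)
      (a := 0) (b := t) (F := fun (k : ℕ) s => ψ (t - s) * convPow ψ k s)
      (f := fun s => ψ (t - s) * ∑' k, convPow ψ k (max s 0))
      (fun (k : ℕ) _ => M * (M * ((M * t) ^ k / k.factorial)))
      (fun k => by
        have := convPow_cont ψ hψ k
        exact Continuous.aestronglyMeasurable (by fun_prop))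
      (fun k => Eventually.of_forall fun s hs => by
        rw [uIoc_of_le ht] at hs
        rw [norm_mul]
        exact mul_le_mul (hM _ (by linarith [hs.2])) (hb k s t hs.1.le hs.2) (norm_nonneg _) hM0)
      (Eventually.of_forall fun s _ => (hsum t).mul_left M)
      intervalIntegrable_const
      (Eventually.of_forall fun s hs => by
        rw [uIoc_of_le ht] at hs
        rw [max_eq_left hs.1.le]
        exact (hS s hs.1.le).hasSum.mul_left _)
    exact this.tsum_eq

end series

lemma conv_to_G (μ : Measure ℝ) [IsFiniteMeasure μ] (hpos : ∀ᵐ x ∂μ, 0 < x)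
    (ψ : ℝ → ℝ) (hψ : ∀ t, 0 ≤ t → ψ t = ∫ x, exp (-(x * t)) ∂μ)
    (R : ℝ → ℝ) (hR : Continuous R)
    (hsol : ∀ t, 0 ≤ t → R t = ψ t + ∫ s in (0:ℝ)..t, ψ (t - s) * R s) (t : ℝ) (ht : 0 ≤ t) :
    R t = G μ R 0 t := by
  obtain ⟨C, hC0, hC⟩ := bdd_of_cont R hR t
  have hexp : Integrable (fun x => exp (-(x * t))) μ := by
    refine Integrable.of_bound (Continuous.aestronglyMeasurable (by fun_prop)) 1 ?_
    filter_upwards [hpos] with x hx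
    rw [Real.norm_eq_abs, abs_of_pos (Real.exp_pos _), Real.exp_le_one_iff]
    nlinarith
  have e1 : ∫ s in (0:ℝ)..t, ψ (t - s) * R s =
      ∫ s in (0:ℝ)..t, ∫ x, exp (-(x * (t - s))) * R s ∂μ := by
    apply intervalIntegral.integral_congr
    intro s hs
    rw [uIcc_of_le ht] at hs
    simp only
    rw [hψ (t - s) (by linarith [hs.2]), integral_mul_const]
  have hprod : Integrable (Function.uncurry fun s x => exp (-(x * (t - s))) * R s)
      ((volume.restrict (uIoc 0 t)).prod μ) := by
    have : IsFiniteMeasure (volume.restrict (uIoc 0 t)) := ⟨by simp [uIoc]⟩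
    refine Integrable.of_bound (Continuous.aestronglyMeasurable ?_) C ?_
    · simp only [Function.uncurry_def]
      fun_prop
    · have a1 : ∀ᵐ s ∂(volume.restrict (uIoc 0 t)), s ∈ uIoc 0 t :=
        ae_restrict_mem measurableSet_uIoc
      have a2 := (Measure.quasiMeasurePreserving_fst (μ := volume.restrict (uIoc 0 t)) (ν := μ)).ae a1
      have a3 := (Measure.quasiMeasurePreserving_snd (μ := volume.restrict (uIoc 0 t)) (ν := μ)).ae hpos
      filter_upwards [a2, a3] with p hp hx
      rw [uIoc_of_le ht] at hp
      simp only [Function.uncurry]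
      rw [Real.norm_eq_abs, abs_mul, abs_of_pos (Real.exp_pos _)]
      have h3 : exp (-(p.2 * (t - p.1))) ≤ 1 := by
        rw [Real.exp_le_one_iff]; nlinarith [hp.2]
      exact (mul_le_of_le_one_left (abs_nonneg _) h3).trans (hC _ hp.1.le hp.2)
  have hprod2 : Integrable (fun x => ∫ s in (0:ℝ)..t, exp (-(x * (t - s))) * R s) μ := by
    have hc : Continuous (fun x => ∫ s in (0:ℝ)..t, exp (-(x * (t - s))) * R s) :=
      intervalIntegral.continuous_parametric_intervalIntegral_of_continuous
        (f := fun x s => exp (-(x * (t - s))) * R s) (by fun_prop) continuous_const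
    refine Integrable.of_bound hc.aestronglyMeasurable (C * t) ?_
    filter_upwards [hpos] with x hx
    exact int_bound R t C hC x t hx.le ht le_rfl
  rw [hsol t ht, hψ t ht, e1, intervalIntegral_integral_swap hprod, ← integral_add hexp hprod2]
  simp [G, U]

/-- The density of the representing measure. -/
noncomputable def wt (c α b x : ℝ) : ℝ := c * (x ^ α * exp (-(b * x)))

noncomputable def muW (c α b : ℝ) : Measure ℝ :=
  (volume.restrict (Ioi 0)).withDensity (fun x => ENNReal.ofReal (wt c α b x))

lemma wt_meas (c α b : ℝ) : Measurable (fun x => ENNReal.ofReal (wt c α b x)) := by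
  unfold wt
  fun_prop

lemma muW_pos (c α b : ℝ) : ∀ᵐ x ∂(muW c α b), 0 < x :=
  (withDensity_absolutelyContinuous _ _).ae_le (ae_restrict_mem measurableSet_Ioi)

lemma wt_ae (c α b : ℝ) (hc : 0 ≤ c) (f g : ℝ → ℝ)
    (hfg : ∀ x, 0 < x → wt c α b x * f x = g x) :
    (fun x => (ENNReal.ofReal (wt c α b x)).toReal • f x) =ᵐ[volume.restrict (Ioi 0)] g := by
  filter_upwards [ae_restrict_mem measurableSet_Ioi] with x hx
  have hx' : 0 < x := hx
  rw [ENNReal.toReal_ofReal (by unfold wt; positivity), smul_eq_mul, hfg x hx']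

lemma muW_integrable (c α b : ℝ) (hc : 0 ≤ c) (f g : ℝ → ℝ)
    (hfg : ∀ x, 0 < x → wt c α b x * f x = g x) (hg : IntegrableOn g (Ioi 0)) :
    Integrable f (muW c α b) := by
  unfold muW
  rw [integrable_withDensity_iff_integrable_smul' (wt_meas c α b)
    (Eventually.of_forall fun x => ENNReal.ofReal_lt_top)]
  exact (integrable_congr (wt_ae c α b hc f g hfg)).2 hg

lemma muW_integral (c α b : ℝ) (hc : 0 ≤ c) (f g : ℝ → ℝ)
    (hfg : ∀ x, 0 < x → wt c α b x * f x = g x) :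
    ∫ x, f x ∂(muW c α b) = ∫ x in Ioi 0, g x := by
  unfold muW
  rw [integral_withDensity_eq_integral_toReal_smul (wt_meas c α b)
    (Eventually.of_forall fun x => ENNReal.ofReal_lt_top)]
  exact integral_congr_ae (wt_ae c α b hc f g hfg)

lemma gamma_int (s b : ℝ) (hs : -1 < s) (hb : 0 < b) :
    IntegrableOn (fun x : ℝ => x ^ s * exp (-(b * x))) (Ioi 0) := by
  have := integrableOn_rpow_mul_exp_neg_mul_rpow (p := 1) hs one_pos hb
  simpa using this

lemma muW_mom (c α b : ℝ) (hc : 0 ≤ c) (hα : 0 < α) (hb : 0 < b) (k : ℕ) :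
    Integrable (fun x : ℝ => x ^ k) (muW c α b) := by
  refine muW_integrable c α b hc _ (fun x => c * (x ^ (α + k) * exp (-(b * x)))) (fun x hx => ?_)
    ((gamma_int (α + k) b (by have : (0:ℝ) ≤ k := Nat.cast_nonneg k
                              linarith) hb).const_mul c)
  rw [Real.rpow_add hx, Real.rpow_natCast]
  unfold wt; ring

lemma muW_finite (c α b : ℝ) (hc : 0 ≤ c) (hα : 0 < α) (hb : 0 < b) :
    IsFiniteMeasure (muW c α b) := by
  have := muW_mom c α b hc hα hb 0
  simp only [pow_zero] at this
  rwa [integrable_const_iff_isFiniteMeasure one_ne_zero] at this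

end RCM

theorem resolvent_completely_monotone
    (α σ : ℝ) (hα : α ∈ Set.Ioo (1/2 : ℝ) 1) (hσ : 0 < σ)
    (φ : ℝ → ℝ) (hφ : ∀ t : ℝ, φ t = α * σ * (1 + σ * t) ^ (-(α + 1)))
    (Rα : ℝ → ℝ) (hRα : ∀ t : ℝ, Rα t = ∑' k : ℕ, convPow φ k t) :
    (∀ t : ℝ, 0 < t → ContDiffAt ℝ (⊤ : ℕ∞) Rα t) ∧
    (∀ k : ℕ, ∀ t : ℝ, 0 < t → 0 ≤ (-1 : ℝ) ^ k * iteratedDeriv k Rα t) := by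
  have hα0 : 0 < α := lt_trans (by norm_num) hα.1
  -- the globally continuous extension of the kernel
  set ψ : ℝ → ℝ := fun t => φ (max t 0) with hψ
  have hφψ : ∀ t, 0 ≤ t → φ t = ψ t := fun t ht => by simp [hψ, max_eq_left ht]
  have hbase : ∀ t : ℝ, 1 ≤ 1 + σ * max t 0 := fun t => by
    have : 0 ≤ max t 0 := le_max_right _ _
    have : 0 ≤ σ * max t 0 := by positivity
    linarith
  have hψc : Continuous ψ := by
    simp only [hψ, hφ]
    refine continuous_const.mul (Continuous.rpow_const (by fun_prop) fun t => Or.inl ?_)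
    linarith [hbase t]
  have hψb : ∀ t, 0 ≤ t → |ψ t| ≤ α * σ := by
    intro t _
    simp only [hψ, hφ]
    have h0 : 0 ≤ (1 + σ * max t 0) ^ (-(α + 1)) := Real.rpow_nonneg (by linarith [hbase t]) _
    rw [abs_of_nonneg (by positivity)]
    exact mul_le_of_le_one_right (by positivity)
      (Real.rpow_le_one_of_one_le_of_nonpos (hbase t) (by linarith))
  obtain ⟨R, hRc, hRs, hRe⟩ := RCM.series_sol ψ hψc (α * σ) hψb
  have hRR : ∀ t, 0 ≤ t → Rα t = R t := by
    intro t ht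
    rw [hRα, hRs t ht]
    exact tsum_congr fun k => RCM.convPow_congr φ ψ hφψ k t ht
  -- the representing measure
  set c : ℝ := α * σ * (σ⁻¹) ^ (α + 1) / Real.Gamma (α + 1) with hc
  have hG : 0 < Real.Gamma (α + 1) := Real.Gamma_pos_of_pos (by linarith)
  have hc0 : 0 ≤ c := by positivity
  have hb : 0 < σ⁻¹ := by positivity
  set μ := RCM.muW c α σ⁻¹ with hμ
  have : IsFiniteMeasure μ := RCM.muW_finite c α σ⁻¹ hc0 hα0 hb
  have hpos := RCM.muW_pos c α σ⁻¹
  have hm := RCM.muW_mom c α σ⁻¹ hc0 hα0 hb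
  have hrep : ∀ t, 0 ≤ t → ψ t = ∫ x, exp (-(x * t)) ∂μ := by
    intro t ht
    rw [hμ, RCM.muW_integral c α σ⁻¹ hc0 _
      (fun x => c * (x ^ (α + 1 - 1) * exp (-((σ⁻¹ + t) * x)))) (fun x hx => by
        unfold RCM.wt
        rw [add_sub_cancel_right, mul_assoc, mul_assoc, ← Real.exp_add]
        ring_nf)]
    rw [integral_const_mul, Real.integral_rpow_mul_exp_neg_mul_Ioi (by linarith) (by positivity),
      ← hφψ t ht, hφ]
    have h1 : (1 + σ * t) ^ (-(α + 1)) = (σ⁻¹) ^ (α + 1) * (1 / (σ⁻¹ + t)) ^ (α + 1) := by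
      rw [← Real.mul_rpow (by positivity) (by positivity), Real.rpow_neg (by positivity),
        ← Real.inv_rpow (by positivity)]
      congr 1
      field_simp
    rw [h1, hc]
    field_simp
  have hwi : ∀ x : ℝ, 0 < x → RCM.wt c α σ⁻¹ x * x⁻¹ = c * (x ^ (α - 1) * exp (-(σ⁻¹ * x))) := by
    intro x hx
    unfold RCM.wt
    rw [Real.rpow_sub_one hx.ne']
    ring
  have hi : Integrable (fun x : ℝ => x⁻¹) μ :=
    RCM.muW_integrable c α σ⁻¹ hc0 _ _ hwi ((RCM.gamma_int (α - 1) σ⁻¹ (by linarith) hb).const_mul c)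
  have h1 : ∫ x, x⁻¹ ∂μ ≤ 1 := by
    rw [hμ, RCM.muW_integral c α σ⁻¹ hc0 _ _ hwi, integral_const_mul,
      Real.integral_rpow_mul_exp_neg_mul_Ioi hα0 hb, hc, Real.Gamma_add_one hα0.ne',
      Real.rpow_add_one hb.ne']
    have hGα : 0 < Real.Gamma α := Real.Gamma_pos_of_pos hα0
    have h2 : (σ⁻¹) ^ α * (1 / σ⁻¹) ^ α = 1 := by
      rw [← Real.mul_rpow (by positivity) (by positivity)]
      rw [mul_one_div_cancel hb.ne', Real.one_rpow]
    apply le_of_eq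
    calc _ = ((σ⁻¹) ^ α * (1 / σ⁻¹) ^ α) * (σ * σ⁻¹) * (α * Real.Gamma α / (α * Real.Gamma α)) := by ring
      _ = 1 := by rw [h2, mul_inv_cancel₀ hσ.ne', div_self (by positivity)]; norm_num
  have hsol := RCM.conv_to_G μ hpos ψ hrep R hRc hRe
  have hev : ∀ t, 0 < t → Rα =ᶠ[nhds t] R := fun t ht => by
    filter_upwards [Ioi_mem_nhds ht] with s hs using hRR s (le_of_lt hs)
  refine ⟨fun t ht => ?_, fun k t ht => ?_⟩
  · exact (RCM.contDiffAt_R μ hpos hm R hRc hsol t ht).congr_of_eventuallyEq (hev t ht)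
  · rw [(hev t ht).iteratedDeriv_eq k]
    exact RCM.main_abs μ hpos hm hi h1 R hRc hsol k t ht
end

section
/- Let α ∈ (0,1) and γ > 0, and let f^{α,γ}(t) = γ t^{α−1} E_{α,α}(−γ t^α) for t > 0. Then lim_{t→∞} t^{α+1} f^{α,γ}(t) = α / (γ Γ(1−α)). -/
open MeasureTheory Real Filter Set

/-- The Mittag-Leffler function `E_{a,k}(x) = ∑_{m=0}^∞ x^m / Γ(a m + k)`. -/
noncomputable def mittagLeffler (a k x : ℝ) : ℝ := ∑' m : ℕ, x ^ m / Real.Gamma (a * m + k)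

/-- The Mittag-Leffler density `f^{a,g}(t) = g t^{a-1} E_{a,a}(-g t^a)`. -/
noncomputable def mlDensity (a g t : ℝ) : ℝ := g * t ^ (a - 1) * mittagLeffler a a (-g * t ^ a)


lemma aux_gamma_laplace (z : ℝ) (hz : 0 < z) (r : ℂ) (hr : 0 < r.re) :
    ∫ t in Ioi (0:ℝ), (t:ℂ) ^ ((z:ℂ) - 1) * Complex.exp (-(r * t)) = r ^ (-(z:ℂ)) * Real.Gamma z := by
  let w : ℝ → NNReal := fun t => Real.toNNReal (t ^ (z-1))
  have hw : Measurable w := by fun_prop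
  let μ : Measure ℝ := (volume.restrict (Ioi (0:ℝ))).withDensity (fun t => (w t : ENNReal))
  have hμ : ∀ s : ℂ, ProbabilityTheory.complexMGF id μ s
      = ∫ t in Ioi (0:ℝ), (t:ℂ) ^ ((z:ℂ) - 1) * Complex.exp (s * t) := by
    intro s
    rw [ProbabilityTheory.complexMGF, integral_withDensity_eq_integral_smul hw]
    apply setIntegral_congr_fun measurableSet_Ioi
    intro t ht
    have ht' : (0:ℝ) < t := ht
    simp only [w, NNReal.smul_def, id, Complex.real_smul]
    rw [Real.coe_toNNReal _ (rpow_nonneg ht'.le _), Complex.ofReal_cpow ht'.le]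
    push_cast
    rfl
  have hset : Iio (0:ℝ) ⊆ ProbabilityTheory.integrableExpSet id μ := by
    intro s hs
    have hs' : s < 0 := hs
    simp only [ProbabilityTheory.integrableExpSet, mem_ofPred_eq, μ]
    rw [integrable_withDensity_iff_integrable_smul hw]
    have := integrableOn_rpow_mul_exp_neg_mul_rpow (p := 1) (s := z - 1) (b := -s) (by linarith) one_pos (by linarith)
    refine (integrableOn_congr_fun ?_ measurableSet_Ioi).mp this
    intro t ht
    have ht' : (0:ℝ) < t := ht
    simp only [w, NNReal.smul_def, id, smul_eq_mul]
    rw [Real.coe_toNNReal _ (rpow_nonneg ht'.le _)]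
    simp
  let U : Set ℂ := {s | s.re < 0}
  have hU : IsOpen U := isOpen_lt Complex.continuous_re continuous_const
  have hd1 : DifferentiableOn ℂ (ProbabilityTheory.complexMGF id μ) U := by
    refine ProbabilityTheory.differentiableOn_complexMGF.mono ?_
    intro s hs
    exact interior_mono hset (by rw [isOpen_Iio.interior_eq]; exact hs)
  have hd2 : DifferentiableOn ℂ (fun s : ℂ => (-s) ^ (-(z:ℂ)) * Real.Gamma z) U := by
    intro s hs
    have hs' : s.re < 0 := hs
    apply DifferentiableAt.differentiableWithinAt
    apply DifferentiableAt.mul_const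
    apply DifferentiableAt.cpow_const differentiableAt_id.neg
    left; simpa using hs'
  have hUc : IsPreconnected U := (convex_halfSpace_re_lt 0).isPreconnected
  have key := (hd1.analyticOnNhd hU).eqOn_of_preconnected_of_frequently_eq (hd2.analyticOnNhd hU) hUc
    (z₀ := -1) (by simp [U]) ?_
  · have := key (show -r ∈ U by simpa [U] using hr)
    rw [hμ] at this
    simpa using this
  · have hreal : ∀ x : ℝ, 0 < x → ProbabilityTheory.complexMGF id μ (-(x:ℂ)) = (-(-(x:ℂ))) ^ (-(z:ℂ)) * Real.Gamma z := by
      intro x hx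
      rw [hμ]
      have := Complex.integral_cpow_mul_exp_neg_mul_Ioi (a := z) (r := x) (by simpa using hz) hx
      simp only [neg_mul]
      rw [this, Complex.Gamma_ofReal, neg_neg, one_div, Complex.inv_cpow, Complex.cpow_neg]
      rw [Complex.arg_ofReal_of_nonneg hx.le]; exact Real.pi_pos.ne
    have ht : Tendsto (fun n : ℕ => -(((1 + 1/((n:ℝ)+1) : ℝ)) : ℂ)) atTop (nhdsWithin (-1) {(-1:ℂ)}ᶜ) := by
      apply tendsto_nhdsWithin_of_tendsto_nhds_of_eventually_within
      · have h1 : Tendsto (fun n : ℕ => (1 + 1/((n:ℝ)+1) : ℝ)) atTop (nhds (1 + 0)) :=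
          tendsto_const_nhds.add tendsto_one_div_add_atTop_nhds_zero_nat
        have h2 := ((Complex.continuous_ofReal.tendsto _).comp h1).neg
        simpa [Function.comp_def] using h2
      · refine Eventually.of_forall fun n => ?_
        simp only [mem_compl_iff, mem_singleton_iff, neg_inj]
        norm_cast
        have : (0:ℝ) < 1/((n:ℝ)+1) := by positivity
        push_cast
        intro h; linarith
    exact ht.frequently (Frequently.of_forall fun n => hreal _ (by positivity))

lemma aux_norm_cpow (s : ℂ) (hs : 0 < s.re) (a : ℝ) : ‖s ^ (a:ℂ)‖ = ‖s‖ ^ a := by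
  rw [Complex.norm_cpow_of_ne_zero (by rintro rfl; simp at hs)]
  simp

lemma aux_line_integrable (R : ℝ) (hR : 0 < R) (z : ℝ) (hz : 1 < z) :
    Integrable (fun u : ℝ => ‖(R:ℂ) + u * Complex.I‖ ^ (-z)) := by
  have h0 := integrable_rpow_neg_one_add_norm_sq (E := ℝ) (μ := volume) (r := z) (by simpa using hz)
  have h := (h0.comp_div hR.ne').const_mul (R ^ (-z))
  refine h.congr (Eventually.of_forall fun u => ?_)
  have hn : ‖(R:ℂ) + u * Complex.I‖ = R * (1 + ‖u / R‖^2) ^ ((1:ℝ)/2) := by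
    rw [Complex.norm_add_mul_I, ← Real.sqrt_eq_rpow, Real.norm_eq_abs, sq_abs]
    have : R ^ 2 + u ^ 2 = R ^ 2 * (1 + (u/R)^2) := by field_simp
    rw [this, Real.sqrt_mul (by positivity), Real.sqrt_sq hR.le]
  simp only
  rw [hn, mul_rpow hR.le (by positivity), ← rpow_mul (by positivity)]
  ring_nf

lemma aux_line_cont (R : ℝ) (hR : 0 < R) (z : ℂ) :
    Continuous (fun u : ℝ => ((R:ℂ) + u * Complex.I) ^ z) := by
  rw [continuous_iff_continuousAt]
  intro u
  refine ContinuousAt.cpow (by fun_prop) continuousAt_const ?_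
  left; simpa using hR

lemma aux_gamma_inv (R : ℝ) (hR : 0 < R) (z : ℝ) (hz : 1 < z) :
    ∫ u : ℝ, Complex.exp ((R:ℂ) + u * Complex.I) * ((R:ℂ) + u * Complex.I) ^ (-(z:ℂ))
      = 2 * π / (Real.Gamma z) := by
  let f : ℝ → ℂ := (Ioi (0:ℝ)).indicator fun t => (t:ℂ) ^ ((z:ℂ) - 1) * Complex.exp (-(R * t))
  have hf : Integrable f := by
    rw [integrable_indicator_iff measurableSet_Ioi]
    have := (integrableOn_rpow_mul_exp_neg_mul_rpow (p := 1) (s := z - 1) (b := R) (by linarith) one_pos hR).ofReal (𝕜 := ℂ)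
    refine (integrableOn_congr_fun ?_ measurableSet_Ioi).mp this
    intro t ht
    have ht' : (0:ℝ) < t := ht
    simp [Complex.ofReal_cpow ht'.le]
  have hF : FourierTransform.fourier f = fun w : ℝ => ((R:ℂ) + (2 * π * w : ℝ) * Complex.I) ^ (-(z:ℂ)) * Real.Gamma z := by
    ext w
    rw [Real.fourier_real_eq_integral_exp_smul, ← aux_gamma_laplace z (by linarith) _ (by simpa using hR),
      ← integral_indicator measurableSet_Ioi]
    congr 1
    ext t
    by_cases ht : t ∈ Ioi (0:ℝ)
    · simp only [f, indicator_of_mem ht, smul_eq_mul]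
      rw [mul_left_comm, ← Complex.exp_add]
      congr 2
      push_cast
      ring
    · simp [f, indicator_of_notMem ht]
  have hFi : Integrable (FourierTransform.fourier f) := by
    rw [hF]
    apply Integrable.mul_const
    have h := aux_line_integrable R hR z hz
    have h2 : Integrable (fun u : ℝ => ((R:ℂ) + u * Complex.I) ^ (-(z:ℂ))) := by
      refine h.mono' (aux_line_cont R hR _).aestronglyMeasurable (Eventually.of_forall fun u => ?_)
      have := aux_norm_cpow ((R:ℂ) + u * Complex.I) (by simpa using hR) (-z)
      push_cast at this
      rw [this]
    exact h2.comp_mul_left' (by positivity : (2 * π) ≠ 0)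
  have hc : ContinuousAt f 1 := by
    have : (fun t : ℝ => (t:ℂ) ^ ((z:ℂ) - 1) * Complex.exp (-(R * t))) =ᶠ[nhds 1] f := by
      filter_upwards [Ioi_mem_nhds (zero_lt_one' ℝ)] with t ht
      simp only [f, indicator_of_mem (show t ∈ Ioi (0:ℝ) from ht)]
    refine ContinuousAt.congr ?_ this
    apply ContinuousAt.mul
    · exact ContinuousAt.cpow (by fun_prop) continuousAt_const (by simp)
    · fun_prop
  have inv := hf.fourierInv_fourier_eq hFi hc
  rw [hF, Real.fourierInv_eq'] at inv
  have hG : (Real.Gamma z : ℂ) ≠ 0 := by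
    exact_mod_cast (Real.Gamma_pos_of_pos (by linarith)).ne'
  have hs := Measure.integral_comp_mul_left (fun u : ℝ => Complex.exp ((R:ℂ) + u * Complex.I) * ((R:ℂ) + u * Complex.I) ^ (-(z:ℂ))) (2 * π)
  have h3 : ∫ v : ℝ, Complex.exp (((2 * π * inner ℝ v 1 : ℝ) : ℂ) * Complex.I) • (((R:ℂ) + (2 * π * v : ℝ) * Complex.I) ^ (-(z:ℂ)) * (Real.Gamma z : ℂ))
     = (Complex.exp (-R) * Real.Gamma z) * ∫ v : ℝ, Complex.exp ((R:ℂ) + (2 * π * v : ℝ) * Complex.I) * ((R:ℂ) + (2 * π * v : ℝ) * Complex.I) ^ (-(z:ℂ)) := by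
    rw [← integral_const_mul]
    congr 1
    ext v
    rw [Complex.exp_add, Complex.exp_neg]
    have := Complex.exp_ne_zero (R:ℂ)
    simp
    field_simp
  rw [h3, hs] at inv
  have h1 : f 1 = Complex.exp (-R) := by
    simp [f]
  rw [h1, abs_of_pos (by positivity)] at inv
  have he := Complex.exp_ne_zero (-(R:ℂ))
  have hpi : (π:ℂ) ≠ 0 := by exact_mod_cast Real.pi_ne_zero
  rw [Complex.real_smul] at inv
  push_cast at inv
  rw [eq_div_iff hG]
  field_simp at inv
  rw [mul_comm, inv]

lemma aux_shift (F : ℂ → ℂ) (R₁ R₂ : ℝ) (h1 : 0 < R₁) (h12 : R₁ ≤ R₂) (C z : ℝ) (hz : 1 < z)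
    (hd : ∀ s : ℂ, 0 < s.re → DifferentiableAt ℂ F s)
    (hb : ∀ s : ℂ, 0 < s.re → s.re ≤ R₂ → ‖F s‖ ≤ C * ‖s‖ ^ (-z)) :
    ∫ u : ℝ, F (R₁ + u * Complex.I) = ∫ u : ℝ, F (R₂ + u * Complex.I) := by
  have hC : 0 ≤ C := by
    have := (norm_nonneg _).trans (hb R₁ (by simpa using h1) (by simpa using h12))
    have h2 : 0 < ‖(R₁:ℂ)‖ ^ (-z) := by
      apply rpow_pos_of_pos; simpa using h1.ne'
    exact nonneg_of_mul_nonneg_left this h2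
  have hFInt : ∀ R : ℝ, 0 < R → R ≤ R₂ → Integrable (fun u : ℝ => F (R + u * Complex.I)) := by
    intro R hR hR2
    refine ((aux_line_integrable R hR z hz).const_mul C).mono' ?_ (Eventually.of_forall fun u => ?_)
    · apply Continuous.aestronglyMeasurable
      rw [continuous_iff_continuousAt]
      intro u
      exact ContinuousAt.comp (f := fun u : ℝ => (R:ℂ) + u * Complex.I) (hd _ (by simpa using hR)).continuousAt (by fun_prop)
    · exact hb _ (by simpa using hR) (by simpa using hR2)
  have ht : ∀ R : ℝ, 0 < R → R ≤ R₂ → Tendsto (fun T : ℝ => ∫ u in (-T)..T, F (R + u * Complex.I)) atTop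
      (nhds (∫ u : ℝ, F (R + u * Complex.I))) := fun R hR hR2 =>
    intervalIntegral_tendsto_integral (hFInt R hR hR2) tendsto_neg_atTop_atBot tendsto_id
  have hhor : ∀ e : ℝ, |e| = 1 → Tendsto (fun T : ℝ => ∫ x in R₁..R₂, F (x + (e * T : ℝ) * Complex.I)) atTop (nhds 0) := by
    intro e he
    have hlim : Tendsto (fun T : ℝ => C * T ^ (-z) * |R₂ - R₁|) atTop (nhds (C * 0 * |R₂ - R₁|)) :=
      ((tendsto_rpow_neg_atTop (by linarith : 0 < z)).const_mul C).mul_const _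
    rw [mul_zero, zero_mul] at hlim
    refine squeeze_zero_norm' ?_ hlim
    filter_upwards [eventually_gt_atTop 0] with T hT
    apply intervalIntegral.norm_integral_le_of_norm_le_const
    intro x hx
    rw [uIoc_of_le h12] at hx
    refine (hb _ (by simpa using h1.trans hx.1) (by simpa using hx.2)).trans ?_
    gcongr ?_ * ?_
    apply rpow_le_rpow_of_nonpos hT _ (by linarith)
    have := Complex.abs_im_le_norm ((x:ℂ) + (e * T : ℝ) * Complex.I)
    simp only [Complex.add_im, Complex.ofReal_im, Complex.mul_im, Complex.ofReal_re, Complex.I_im, Complex.I_re] at this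
    simpa [abs_mul, he, abs_of_pos hT] using this
  have hrect : ∀ T : ℝ, (((∫ x in R₁..R₂, F (x + (-1 * T : ℝ) * Complex.I)) - ∫ x in R₁..R₂, F (x + (1 * T : ℝ) * Complex.I)) +
      Complex.I • ∫ y in (-T)..T, F (R₂ + y * Complex.I)) - Complex.I • ∫ y in (-T)..T, F (R₁ + y * Complex.I) = 0 := by
    intro T
    have := Complex.integral_boundary_rect_eq_zero_of_differentiableOn F ⟨R₁, -T⟩ ⟨R₂, T⟩ ?_
    · simpa using this
    · intro s hs
      apply (hd s _).differentiableWithinAt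
      have := (Complex.mem_reProdIm.mp hs).1
      simp only [uIcc_of_le h12] at this
      exact h1.trans_le this.1
  have hl := (((hhor (-1) (by simp)).sub (hhor 1 (by simp))).add ((ht R₂ (h1.trans_le h12) le_rfl).const_smul Complex.I)).sub
    ((ht R₁ h1 h12).const_smul Complex.I)
  have hl0 := tendsto_nhds_unique (hl.congr hrect) tendsto_const_nhds
  rw [sub_zero, zero_add, ← smul_sub, smul_eq_zero] at hl0
  rcases hl0 with h | h
  · exact absurd h Complex.I_ne_zero
  · exact (sub_eq_zero.mp h).symm

/-- The kernel obtained by summing the Hankel-type integrals. -/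
noncomputable def auxH (a l : ℝ) (s : ℂ) : ℂ :=
  l * ((s ^ 2)⁻¹ * s ^ (-(a:ℂ))) * (a * (1 - a) / (1 + l * s ^ (-(a:ℂ))) ^ 2 + 2 * a ^ 2 / (1 + l * s ^ (-(a:ℂ))) ^ 3)

lemma aux_re_pos (a : ℝ) (ha : a ∈ Ioo (0:ℝ) 1) (s : ℂ) (hs : 0 < s.re) : 0 < (s ^ (-(a:ℂ))).re := by
  have hs0 : s ≠ 0 := by rintro rfl; simp at hs
  rw [Complex.cpow_def_of_ne_zero hs0, Complex.exp_re]
  apply mul_pos (Real.exp_pos _)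
  have him : (Complex.log s * -(a:ℂ)).im = -(s.arg * a) := by
    simp [Complex.log_im]
  rw [him, Real.cos_neg]
  have h := abs_lt.mp (Complex.abs_arg_lt_pi_div_two_iff.mpr (Or.inl hs))
  have hpi := Real.pi_pos
  apply Real.cos_pos_of_mem_Ioo
  constructor <;> nlinarith [ha.1, ha.2, h.1, h.2]

lemma aux_den (a l : ℝ) (ha : a ∈ Ioo (0:ℝ) 1) (hl : 0 < l) (s : ℂ) (hs : 0 < s.re) :
    1 ≤ ‖1 + l * s ^ (-(a:ℂ))‖ ∧ l * ‖s‖ ^ (-a) ≤ ‖1 + l * s ^ (-(a:ℂ))‖ := by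
  have h := aux_re_pos a ha s hs
  have hn := aux_norm_cpow s hs (-a)
  push_cast at hn
  constructor
  · have := Complex.re_le_norm (1 + l * s ^ (-(a:ℂ)))
    simp at this
    nlinarith [mul_pos hl h]
  · rw [← hn]
    have e : l * ‖s ^ (-(a:ℂ))‖ = ‖(l:ℂ) * s ^ (-(a:ℂ))‖ := by simp [abs_of_pos hl]
    rw [e, ← sq_le_sq₀ (norm_nonneg _) (norm_nonneg _), Complex.sq_norm, Complex.sq_norm, Complex.normSq_apply, Complex.normSq_apply]
    have := mul_pos hl h
    simp
    nlinarith

lemma aux_H_bound (a l : ℝ) (ha : a ∈ Ioo (0:ℝ) 1) (hl : 0 < l) (s : ℂ) (hs : 0 < s.re) :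
    ‖auxH a l s‖ ≤ 3 / l * ‖s‖ ^ (-(2 - a)) := by
  obtain ⟨h1, h2⟩ := aux_den a l ha hl s hs
  have hn := aux_norm_cpow s hs (-a)
  push_cast at hn
  have hs0 : 0 < ‖s‖ := by
    rw [norm_pos_iff]; rintro rfl; simp at hs
  set D := 1 + l * s ^ (-(a:ℂ)) with hD
  set w := ‖s‖ ^ (-a) with hw
  have hwp : 0 < w := rpow_pos_of_pos hs0 _
  have hDp : 0 < ‖D‖ := by linarith
  have e1 : ‖s‖ ^ (-(2 - a)) = (‖s‖ ^ 2)⁻¹ * w⁻¹ := by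
    rw [hw, ← rpow_neg hs0.le, ← Real.rpow_natCast, ← rpow_neg hs0.le, ← rpow_add hs0]
    congr 1; push_cast; ring
  have hsum : ‖(a * (1 - a) / D ^ 2 + 2 * a ^ 2 / D ^ 3 : ℂ)‖ ≤ 3 / (l * w) ^ 2 := by
    have b1 : ‖(a * (1 - a) / D ^ 2 : ℂ)‖ ≤ 1 / (l * w) ^ 2 := by
      rw [norm_div, norm_pow]
      gcongr
      have : (a * (1 - a) : ℂ) = ((a * (1 - a) : ℝ) : ℂ) := by push_cast; rfl
      rw [this, Complex.norm_real, Real.norm_eq_abs, abs_le]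
      constructor <;> nlinarith [ha.1, ha.2]
    have b2 : ‖(2 * a ^ 2 / D ^ 3 : ℂ)‖ ≤ 2 / (l * w) ^ 2 := by
      rw [norm_div, norm_pow]
      have : ‖(2 * a ^ 2 : ℂ)‖ ≤ 2 := by
        simp [abs_of_pos ha.1]
        nlinarith [ha.1, ha.2]
      have : (l * w) ^ 2 ≤ ‖D‖ ^ 3 := by
        calc (l * w) ^ 2 ≤ ‖D‖ ^ 2 := by gcongr
          _ ≤ ‖D‖ ^ 3 := by gcongr; norm_num
      gcongr
    calc _ ≤ _ := norm_add_le _ _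
      _ ≤ 1 / (l * w) ^ 2 + 2 / (l * w) ^ 2 := by gcongr
      _ = _ := by ring
  rw [auxH, norm_mul, norm_mul, norm_mul, norm_inv, norm_pow, hn, Complex.norm_real, Real.norm_eq_abs, abs_of_pos hl, e1]
  calc _ ≤ l * ((‖s‖ ^ 2)⁻¹ * w) * (3 / (l * w) ^ 2) := by gcongr
    _ = _ := by field_simp

lemma aux_D_ne (a l : ℝ) (ha : a ∈ Ioo (0:ℝ) 1) (hl : 0 < l) (s : ℂ) (hs : 0 < s.re) :
    1 + l * s ^ (-(a:ℂ)) ≠ 0 := by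
  intro h
  have := (aux_den a l ha hl s hs).1
  rw [h] at this
  simp at this
  linarith

lemma aux_H_diff (a l : ℝ) (ha : a ∈ Ioo (0:ℝ) 1) (hl : 0 < l) (s : ℂ) (hs : 0 < s.re) :
    DifferentiableAt ℂ (auxH a l) s := by
  have hs0 : s ≠ 0 := by rintro rfl; simp at hs
  have hD := aux_D_ne a l ha hl s hs
  have hc : DifferentiableAt ℂ (fun s : ℂ => s ^ (-(a:ℂ))) s :=
    differentiableAt_id.cpow_const (Or.inl hs)
  have hD' : DifferentiableAt ℂ (fun s : ℂ => 1 + l * s ^ (-(a:ℂ))) s := (hc.const_mul _).const_add _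
  unfold auxH
  refine DifferentiableAt.mul (DifferentiableAt.const_mul (DifferentiableAt.mul ?_ hc) _) (DifferentiableAt.add ?_ ?_)
  · exact (differentiableAt_id.pow 2).inv (pow_ne_zero _ hs0)
  · exact (differentiableAt_const _).div (hD'.pow 2) (pow_ne_zero _ hD)
  · exact (differentiableAt_const _).div (hD'.pow 3) (pow_ne_zero _ hD)

lemma aux_cont_line (F : ℂ → ℂ) (hd : ∀ s : ℂ, 0 < s.re → DifferentiableAt ℂ F s) (R : ℝ) (hR : 0 < R) :
    Continuous (fun u : ℝ => F (R + u * Complex.I)) := by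
  rw [continuous_iff_continuousAt]
  intro u
  exact ContinuousAt.comp (f := fun u : ℝ => (R:ℂ) + u * Complex.I) (hd _ (by simpa using hR)).continuousAt (by fun_prop)

/-- Summation of the series on the line. -/
lemma aux_hasSum (a l : ℝ) (hl : 0 < l) (s : ℂ) (hs : 0 < s.re) (hx : l * ‖s‖ ^ (-a) < 1) :
    HasSum (fun m : ℕ => (l * (-l) ^ m * ((a * m + a) * (a * m + a + 1)) : ℂ) * s ^ (-((a * m + a + 2 : ℝ) : ℂ)))
      (auxH a l s) := by
  have hs0 : s ≠ 0 := by rintro rfl; simp at hs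
  have hn := aux_norm_cpow s hs (-a)
  push_cast at hn
  set w := s ^ (-(a:ℂ)) with hw
  have hr : ‖-(l * w)‖ < 1 := by
    rw [norm_neg, norm_mul, hn]; simpa [abs_of_pos hl] using hx
  have h1 := (hasSum_choose_mul_geometric_of_norm_lt_one 1 hr).mul_left ((l:ℂ) * ((s ^ 2)⁻¹ * w) * (a * (1 - a)))
  have h2 := (hasSum_choose_mul_geometric_of_norm_lt_one 2 hr).mul_left ((l:ℂ) * ((s ^ 2)⁻¹ * w) * (2 * a ^ 2))
  have h3 := h1.add h2
  have hv : (l:ℂ) * ((s ^ 2)⁻¹ * w) * (a * (1 - a)) * (1 / (1 - -(l * w)) ^ (1 + 1)) +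
      (l:ℂ) * ((s ^ 2)⁻¹ * w) * (2 * a ^ 2) * (1 / (1 - -(l * w)) ^ (2 + 1)) = auxH a l s := by
    rw [auxH, ← hw]
    simp only [sub_neg_eq_add]
    ring
  rw [hv] at h3
  refine h3.congr_fun ?_
  intro m
  have e : s ^ (-((a * m + a + 2 : ℝ) : ℂ)) = (s ^ 2)⁻¹ * w * w ^ m := by
    have : (-((a * m + a + 2 : ℝ) : ℂ)) = -(2:ℕ) + (-(a:ℂ)) + m * (-(a:ℂ)) := by push_cast; ring
    rw [this, Complex.cpow_add _ _ hs0, Complex.cpow_add _ _ hs0, Complex.cpow_nat_mul, Complex.cpow_neg s (2:ℕ), Complex.cpow_natCast]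
  have c2 : (((m + 2).choose 2 : ℕ) : ℂ) = (m + 1) * (m + 2) / 2 := by
    rw [Nat.cast_choose_two]; push_cast; ring
  rw [e, c2]
  simp only [Nat.choose_one_right]
  push_cast
  rw [neg_pow, neg_pow ((l:ℂ) * w), mul_pow]
  ring

lemma aux_series (a l R : ℝ) (ha : a ∈ Ioo (0:ℝ) 1) (hl : 0 < l) (hR : 0 < R) (hx : l * R ^ (-a) < 1) :
    ∫ u : ℝ, Complex.exp ((R:ℂ) + u * Complex.I) * auxH a l ((R:ℂ) + u * Complex.I)
      = 2 * π * ((l * mittagLeffler a a (-l) : ℝ) : ℂ) := by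
  have hRn : ∀ u : ℝ, R ≤ ‖(R:ℂ) + u * Complex.I‖ := by
    intro u
    have := Complex.re_le_norm ((R:ℂ) + u * Complex.I)
    simpa using this
  have hre : ∀ u : ℝ, 0 < ((R:ℂ) + u * Complex.I).re := by intro u; simpa using hR
  let F : ℕ → ℝ → ℂ := fun m u => (l * (-l) ^ m * ((a * m + a) * (a * m + a + 1)) : ℂ) *
    (Complex.exp ((R:ℂ) + u * Complex.I) * ((R:ℂ) + u * Complex.I) ^ (-((a * m + a + 2 : ℝ) : ℂ)))
  have hp : ∀ m : ℕ, 0 < a * m + a := fun m => by have := ha.1; positivity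
  have hFn : ∀ m u, ‖F m u‖ = l * l ^ m * ((a * m + a) * (a * m + a + 1)) * (Real.exp R * ‖(R:ℂ) + u * Complex.I‖ ^ (-(a * m + a + 2))) := by
    intro m u
    have h1 : (l * (-l) ^ m * ((a * m + a) * (a * m + a + 1)) : ℂ) = ((l * (-l) ^ m * ((a * m + a) * (a * m + a + 1)) : ℝ) : ℂ) := by
      push_cast; rfl
    have h2 := aux_norm_cpow _ (hre u) (-(a * m + a + 2))
    rw [Complex.ofReal_neg] at h2
    have := hp m
    simp only [F]
    rw [norm_mul, h1, Complex.norm_real, norm_mul (Complex.exp _), h2, Complex.norm_exp, norm_mul, norm_mul, norm_pow, norm_neg,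
      Real.norm_of_nonneg hl.le, Real.norm_of_nonneg (by positivity : 0 ≤ (a * m + a) * (a * m + a + 1))]
    simp
  have hFint : ∀ m, Integrable (F m) := by
    intro m
    have := hp m
    refine (((aux_line_integrable R hR (a * m + a + 2) (by linarith)).const_mul (Real.exp R)).const_mul
      (l * l ^ m * ((a * m + a) * (a * m + a + 1)))).mono' ?_ (Eventually.of_forall fun u => (hFn m u).le)
    apply Continuous.aestronglyMeasurable
    have := aux_line_cont R hR (-((a * m + a + 2 : ℝ) : ℂ))
    simp only [F]
    fun_prop
  set I2 := ∫ u : ℝ, ‖(R:ℂ) + u * Complex.I‖ ^ (-(2:ℝ)) with hI2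
  have hI2n : 0 ≤ I2 := integral_nonneg fun u => by positivity
  set x := l * R ^ (-a) with hxdef
  have hx0 : 0 < x := by positivity
  have hsum : Summable fun m => ∫ u : ℝ, ‖F m u‖ := by
    have hs := ((hasSum_choose_mul_geometric_of_norm_lt_one 2 (r := x) (by rwa [Real.norm_of_nonneg hx0.le])).summable).mul_left
      (x * (2 * (Real.exp R * I2)))
    refine Summable.of_nonneg_of_le (fun m => integral_nonneg fun u => norm_nonneg _) (fun m => ?_) hs
    have hpm := hp m
    calc ∫ u : ℝ, ‖F m u‖ ≤ ∫ u : ℝ, x * x ^ m * ((m + 1) * (m + 2)) * (Real.exp R * ‖(R:ℂ) + u * Complex.I‖ ^ (-(2:ℝ))) := by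
          apply integral_mono (hFint m).norm
          · exact ((aux_line_integrable R hR 2 (by norm_num)).const_mul _).const_mul _
          · intro u
            simp only [hFn]
            have hn0 : 0 < ‖(R:ℂ) + u * Complex.I‖ := hR.trans_le (hRn u)
            have e : -(a * m + a + 2) = (-(a * m + a)) + (-2) := by ring
            have e3 : x * x ^ m = l * l ^ m * R ^ (-(a * m + a)) := by
              rw [hxdef, mul_pow, ← Real.rpow_natCast (R ^ (-a)), ← Real.rpow_mul hR.le]
              have : -(a * m + a) = -a + -a * m := by ring
              rw [this, Real.rpow_add hR]; ring
            rw [e, Real.rpow_add hn0, e3]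
            have b1 : ‖(R:ℂ) + u * Complex.I‖ ^ (-(a * m + a)) ≤ R ^ (-(a * m + a)) :=
              rpow_le_rpow_of_nonpos hR (hRn u) (by linarith)
            have b2 : (a * m + a) * (a * m + a + 1) ≤ ((m:ℝ) + 1) * (m + 2) := by
              have : a * m + a ≤ m + 1 := by
                have : (0:ℝ) ≤ m := Nat.cast_nonneg m
                nlinarith [ha.1, ha.2]
              apply mul_le_mul this (by linarith) (by linarith) (by positivity)
            calc _ ≤ l * l ^ m * ((m + 1) * (m + 2)) * (Real.exp R * (R ^ (-(a * m + a)) * ‖(R:ℂ) + u * Complex.I‖ ^ (-(2:ℝ)))) := by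
                  gcongr
              _ = _ := by ring
      _ = _ := by
          rw [integral_const_mul, integral_const_mul, ← hI2, Nat.cast_choose_two]
          push_cast; ring
  have hS := hasSum_integral_of_summable_integral_norm hFint hsum
  have hI : ∀ m, ∫ u, F m u = 2 * π * ((l * ((-l) ^ m / Real.Gamma (a * m + a)) : ℝ) : ℂ) := by
    intro m
    have hpm := hp m
    simp only [F]
    rw [integral_const_mul, aux_gamma_inv R hR (a * m + a + 2) (by linarith)]
    have g : Real.Gamma (a * m + a + 2) = (a * m + a + 1) * ((a * m + a) * Real.Gamma (a * m + a)) := by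
      rw [← Real.Gamma_add_one hpm.ne', ← Real.Gamma_add_one (by linarith : a * m + a + 1 ≠ 0)]
      congr 1; ring
    have hG := (Real.Gamma_pos_of_pos hpm).ne'
    have h0 : (l * (-l) ^ m * ((a * m + a) * (a * m + a + 1)) : ℂ) * (2 * π / (Real.Gamma (a * m + a + 2) : ℝ))
      = ((l * (-l) ^ m * ((a * m + a) * (a * m + a + 1)) * (2 * π / Real.Gamma (a * m + a + 2)) : ℝ) : ℂ) := by
      push_cast; rfl
    rw [h0]
    have h1 : (2 * π * ((l * ((-l) ^ m / Real.Gamma (a * m + a)) : ℝ) : ℂ)) = ((2 * π * (l * ((-l) ^ m / Real.Gamma (a * m + a))) : ℝ) : ℂ) := by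
      push_cast; rfl
    rw [h1, g]
    congr 1
    have : a * m + a + 1 ≠ 0 := by linarith
    have := hpm.ne'
    generalize a * m + a = p at *
    field_simp
  have hL : ∫ u : ℝ, ∑' m, F m u = ∫ u : ℝ, Complex.exp ((R:ℂ) + u * Complex.I) * auxH a l ((R:ℂ) + u * Complex.I) := by
    congr 1
    ext u
    have := (aux_hasSum a l hl _ (hre u) (lt_of_le_of_lt (by
      have := rpow_le_rpow_of_nonpos hR (hRn u) (by linarith [ha.1] : -a ≤ 0)
      exact mul_le_mul_of_nonneg_left this hl.le) hx)).mul_left (Complex.exp ((R:ℂ) + u * Complex.I))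
    rw [← this.tsum_eq]
    congr 1
    ext m
    simp only [F]
    ring
  rw [← hL, ← hS.tsum_eq]
  simp_rw [hI]
  rw [tsum_mul_left, ← Complex.ofReal_tsum, tsum_mul_left]
  rfl

lemma aux_exists_R (a l : ℝ) (ha : 0 < a) : ∃ R : ℝ, 1 ≤ R ∧ l * R ^ (-a) < 1 := by
  have h := (tendsto_rpow_neg_atTop ha).const_mul l
  rw [mul_zero] at h
  obtain ⟨R, h1, h2⟩ := ((h.eventually_lt_const zero_lt_one).and (eventually_ge_atTop 1)).exists
  exact ⟨R, h2, h1⟩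

lemma aux_repr (a l : ℝ) (ha : a ∈ Ioo (0:ℝ) 1) (hl : 0 < l) :
    ∫ u : ℝ, Complex.exp (((1:ℝ):ℂ) + u * Complex.I) * auxH a l (((1:ℝ):ℂ) + u * Complex.I)
      = 2 * π * ((l * mittagLeffler a a (-l) : ℝ) : ℂ) := by
  obtain ⟨R, hR, hx⟩ := aux_exists_R a l ha.1
  rw [← aux_series a l R ha hl (by linarith) hx]
  refine aux_shift (fun s => Complex.exp s * auxH a l s) 1 R one_pos hR (Real.exp R * (3 / l)) (2 - a)
    (by linarith [ha.2]) ?_ ?_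
  · intro s hs
    exact Complex.differentiableAt_exp.mul (aux_H_diff a l ha hl s hs)
  · intro s hs hsR
    rw [norm_mul, Complex.norm_exp, mul_assoc]
    gcongr
    exact aux_H_bound a l ha hl s hs

lemma aux_limit (a : ℝ) (ha : a ∈ Ioo (0:ℝ) 1) :
    Tendsto (fun l : ℝ => ∫ u : ℝ, (l:ℂ) * (Complex.exp (((1:ℝ):ℂ) + u * Complex.I) * auxH a l (((1:ℝ):ℂ) + u * Complex.I)))
      atTop (nhds (∫ u : ℝ, (a * (1 - a) : ℂ) * (Complex.exp (((1:ℝ):ℂ) + u * Complex.I) * (((1:ℝ):ℂ) + u * Complex.I) ^ (-((2 - a : ℝ) : ℂ))))) := by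
  have hre : ∀ u : ℝ, 0 < (((1:ℝ):ℂ) + u * Complex.I).re := by intro u; simp
  refine tendsto_integral_filter_of_dominated_convergence
    (fun u : ℝ => (Real.exp 1 * 3) * ‖((1:ℝ):ℂ) + u * Complex.I‖ ^ (-(2 - a))) ?_ ?_ ?_ ?_
  · filter_upwards [eventually_gt_atTop 0] with l hl
    have := aux_cont_line (auxH a l) (fun s hs => aux_H_diff a l ha hl s hs) 1 one_pos
    apply Continuous.aestronglyMeasurable
    fun_prop
  · filter_upwards [eventually_gt_atTop 0] with l hl
    refine Eventually.of_forall fun u => ?_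
    have := aux_H_bound a l ha hl _ (hre u)
    rw [norm_mul, norm_mul, Complex.norm_exp, Complex.norm_real, Real.norm_of_nonneg hl.le]
    have e : ((((1:ℝ):ℂ) + u * Complex.I)).re = 1 := by simp
    rw [e]
    calc _ ≤ l * (Real.exp 1 * (3 / l * ‖((1:ℝ):ℂ) + u * Complex.I‖ ^ (-(2 - a)))) := by gcongr
      _ = _ := by field_simp
  · exact (aux_line_integrable 1 one_pos (2 - a) (by linarith [ha.2])).const_mul _
  · refine Eventually.of_forall fun u => ?_
    set s := ((1:ℝ):ℂ) + u * Complex.I with hs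
    have hs0 : s ≠ 0 := by intro h; have := hre u; rw [← hs, h] at this; simp at this
    set w := s ^ (-(a:ℂ)) with hw
    have hw0 : w ≠ 0 := by rw [hw, Complex.cpow_ne_zero_iff]; exact Or.inl hs0
    have hinv : Tendsto (fun l : ℝ => ((l⁻¹ : ℝ) : ℂ)) atTop (nhds ((0:ℝ):ℂ)) :=
      (Complex.continuous_ofReal.tendsto _).comp tendsto_inv_atTop_zero
    rw [Complex.ofReal_zero] at hinv
    have hlim : Tendsto (fun l : ℝ => Complex.exp s * ((s ^ 2)⁻¹ * w) * (a * (1 - a) / (((l⁻¹ : ℝ) : ℂ) + w) ^ 2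
        + ((l⁻¹ : ℝ) : ℂ) * (2 * a ^ 2) / (((l⁻¹ : ℝ) : ℂ) + w) ^ 3)) atTop
        (nhds (Complex.exp s * ((s ^ 2)⁻¹ * w) * (a * (1 - a) / (0 + w) ^ 2 + 0 * (2 * a ^ 2) / (0 + w) ^ 3))) := by
      have hd := hinv.add_const w
      refine Tendsto.const_mul _ (Tendsto.add ?_ ?_)
      · exact tendsto_const_nhds.div (hd.pow 2) (by simpa using hw0)
      · exact (hinv.mul_const _).div (hd.pow 3) (by simpa using hw0)
    have e : s ^ (-((2 - a : ℝ) : ℂ)) = (s ^ 2)⁻¹ * w⁻¹ := by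
      have : (-((2 - a : ℝ) : ℂ)) = -(2:ℕ) + -(-(a:ℂ)) := by push_cast; ring
      rw [this, Complex.cpow_add _ _ hs0, Complex.cpow_neg s (2:ℕ), Complex.cpow_natCast, Complex.cpow_neg s (-(a:ℂ))]
    have e2 : (a * (1 - a) : ℂ) * (Complex.exp s * s ^ (-((2 - a : ℝ) : ℂ))) =
        Complex.exp s * ((s ^ 2)⁻¹ * w) * (a * (1 - a) / (0 + w) ^ 2 + 0 * (2 * a ^ 2) / (0 + w) ^ 3) := by
      rw [e, zero_add, zero_mul, zero_div, add_zero]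
      field_simp
    rw [e2]
    refine hlim.congr' ?_
    filter_upwards [eventually_gt_atTop 0] with l hl
    have hD := aux_D_ne a l ha hl s (hre u)
    have hl0 : (l:ℂ) ≠ 0 := by exact_mod_cast hl.ne'
    have e3 : ((l⁻¹ : ℝ) : ℂ) + w = (l:ℂ)⁻¹ * (1 + l * w) := by
      push_cast; field_simp
    rw [e3, auxH, ← hw]
    rw [← hw] at hD
    push_cast
    generalize 1 + (l:ℂ) * w = D at *
    field_simp

theorem mlDensity_tail_asymptotics
    (α γ : ℝ) (hα : α ∈ Set.Ioo (0:ℝ) 1) (hγ : 0 < γ) :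
    Tendsto (fun t : ℝ => t ^ (α + 1) * mlDensity α γ t) atTop
      (nhds (α / (γ * Real.Gamma (1 - α)))) := by
  have hpi : (π:ℝ) ≠ 0 := Real.pi_ne_zero
  have hG : 0 < Real.Gamma (1 - α) := Real.Gamma_pos_of_pos (by linarith [hα.2])
  have hlim : Tendsto (fun l : ℝ => l * (l * mittagLeffler α α (-l))) atTop (nhds (α / Real.Gamma (1 - α))) := by
    have h := aux_limit α hα
    rw [integral_const_mul, aux_gamma_inv 1 one_pos (2 - α) (by linarith [hα.2])] at h
    have hg : Real.Gamma (2 - α) = (1 - α) * Real.Gamma (1 - α) := by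
      rw [← Real.Gamma_add_one (by linarith [hα.2])]; congr 1; ring
    have e : (α * (1 - α) : ℂ) * (2 * π / (Real.Gamma (2 - α) : ℝ)) = ((2 * π * (α / Real.Gamma (1 - α)) : ℝ) : ℂ) := by
      have h1 : (1 - α) ≠ 0 := by linarith [hα.2]
      have : α * (1 - α) * (2 * π / Real.Gamma (2 - α)) = 2 * π * (α / Real.Gamma (1 - α)) := by
        rw [hg]; field_simp
      rw [← this]; push_cast; rfl
    rw [e] at h
    have h2 : Tendsto (fun l : ℝ => ((2 * π * (l * (l * mittagLeffler α α (-l))) : ℝ) : ℂ)) atTop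
        (nhds ((2 * π * (α / Real.Gamma (1 - α)) : ℝ) : ℂ)) := by
      refine h.congr' ?_
      filter_upwards [eventually_gt_atTop 0] with l hl
      rw [integral_const_mul, aux_repr α l hα hl]
      push_cast; ring
    have h3 := (Complex.continuous_re.tendsto _).comp h2
    have h4 := h3.const_mul (2 * π)⁻¹
    simp only [Function.comp_def, Complex.ofReal_re] at h4
    have hc : ∀ y : ℝ, (2 * π)⁻¹ * (2 * π * y) = y := by intro y; field_simp
    simpa only [hc] using h4
  have ht : Tendsto (fun t : ℝ => γ * t ^ α) atTop atTop := (tendsto_rpow_atTop hα.1).const_mul_atTop hγ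
  have := (hlim.comp ht).const_mul γ⁻¹
  have ec : γ⁻¹ * (α / Real.Gamma (1 - α)) = α / (γ * Real.Gamma (1 - α)) := by field_simp
  rw [ec] at this
  refine this.congr' ?_
  filter_upwards [eventually_gt_atTop 0] with t ht
  simp only [Function.comp_def, mlDensity]
  have : t ^ (α + 1) * (γ * t ^ (α - 1) * mittagLeffler α α (-γ * t ^ α)) =
      γ * (t ^ (α + 1) * t ^ (α - 1)) * mittagLeffler α α (-(γ * t ^ α)) := by
    rw [neg_mul]; ring
  rw [this, ← rpow_add ht, show α + 1 + (α - 1) = α + α by ring, rpow_add ht]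
  field_simp
end

section
/- Let α ∈ (0,1) and γ > 0, and let f^{α,γ}(t) = γ t^{α−1} E_{α,α}(−γ t^α) for t > 0. Then f^{α,γ} is a probability density on (0,∞): f^{α,γ}(t) ≥ 0 for every t > 0 and ∫_0^∞ f^{α,γ}(t) dt = 1. -/
open MeasureTheory Real Filter Set

lemma ml_beta (s t a : ℝ) (hs : 0 < s) (ht : 0 < t) (ha : 0 < a) :
    ∫ x in (0:ℝ)..a, x ^ (s - 1) * (a - x) ^ (t - 1)
      = a ^ (s + t - 1) * (Real.Gamma s * Real.Gamma t / Real.Gamma (s + t)) := by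
  have h := Complex.betaIntegral_scaled (s : ℂ) (t : ℂ) ha
  rw [Complex.betaIntegral_eq_Gamma_mul_div _ _ (by simpa) (by simpa)] at h
  have h2 : (∫ x in (0:ℝ)..a, (x : ℂ) ^ ((s:ℂ) - 1) * ((a : ℂ) - x) ^ ((t:ℂ) - 1))
      = ((∫ x in (0:ℝ)..a, x ^ (s - 1) * (a - x) ^ (t - 1) : ℝ) : ℂ) := by
    rw [← intervalIntegral.integral_ofReal]
    refine intervalIntegral.integral_congr fun x hx => ?_
    rw [uIcc_of_le ha.le] at hx
    simp only [Complex.ofReal_mul]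
    rw [Complex.ofReal_cpow hx.1, Complex.ofReal_cpow (by linarith [hx.2])]
    push_cast
    rfl
  rw [h2, ← Complex.ofReal_add, Complex.Gamma_ofReal, Complex.Gamma_ofReal,
    Complex.Gamma_ofReal] at h
  apply Complex.ofReal_injective
  rw [h]
  push_cast
  rw [Complex.ofReal_cpow ha.le]
  push_cast
  rfl

lemma ml_beta_int (s t a : ℝ) (hs : 0 < s) (ht : 0 < t) (ha : 0 < a) :
    IntervalIntegrable (fun x => x ^ (s - 1) * (a - x) ^ (t - 1)) volume 0 a := by
  by_contra h
  have h1 := ml_beta s t a hs ht ha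
  rw [intervalIntegral.integral_undef h] at h1
  have := Real.Gamma_pos_of_pos hs
  have := Real.Gamma_pos_of_pos ht
  have := Real.Gamma_pos_of_pos (add_pos hs ht)
  have : 0 < a ^ (s + t - 1) * (Real.Gamma s * Real.Gamma t / Real.Gamma (s + t)) := by positivity
  linarith

lemma ml_gamma_lower (R y : ℝ) (hR : 0 < R) (hy : 1 ≤ y) :
    R ^ (y - 1) * Real.exp (-R) ≤ Real.Gamma y := by
  rw [Real.Gamma_eq_integral (by linarith), ← integral_exp_neg_Ioi R, ← integral_const_mul]
  have hi := Real.GammaIntegral_convergent (show 0 < y by linarith)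
  calc ∫ x in Ioi R, R ^ (y - 1) * Real.exp (-x)
      ≤ ∫ x in Ioi R, Real.exp (-x) * x ^ (y - 1) := by
        refine setIntegral_mono_on ?_ (hi.mono_set (Ioi_subset_Ioi hR.le)) measurableSet_Ioi ?_
        · exact (integrableOn_exp_neg_Ioi R).const_mul _
        · intro x hx
          rw [mul_comm]
          have : R < x := hx
          gcongr
    _ ≤ _ := by
        refine setIntegral_mono_set hi ?_ (Ioi_subset_Ioi hR.le).eventuallyLE
        refine (ae_restrict_mem measurableSet_Ioi).mono fun x hx => ?_
        have : 0 < x := hx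
        simp only [Pi.zero_apply]
        positivity

lemma ml_gamma_pos (a k : ℝ) (ha : 0 < a) (hk : 0 < k) (m : ℕ) : 0 < Real.Gamma (a * m + k) :=
  Real.Gamma_pos_of_pos (by positivity)

lemma ml_summable_nonneg (a k x : ℝ) (ha : 0 < a) (hk : 0 < k) (hx : 0 ≤ x) :
    Summable fun m : ℕ => x ^ m / Real.Gamma (a * m + k) := by
  set R : ℝ := (2 * x + 1) ^ (1 / a) with hRdef
  have hR : 0 < R := by positivity
  have hRa : R ^ a = 2 * x + 1 := by
    rw [hRdef, ← Real.rpow_mul (by positivity), one_div, inv_mul_cancel₀ ha.ne', Real.rpow_one]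
  have hg : Summable fun m : ℕ => (Real.exp R * R ^ (1 - k)) * (1 / 2 : ℝ) ^ m :=
    (summable_geometric_of_lt_one (by norm_num) (by norm_num)).mul_left _
  refine Summable.of_norm_bounded_eventually_nat hg ?_
  have h1 : ∀ᶠ m : ℕ in atTop, 1 ≤ a * m + k := by
    have : Tendsto (fun m : ℕ => a * (m : ℝ) + k) atTop atTop :=
      tendsto_atTop_add_const_right _ _ (tendsto_natCast_atTop_atTop.const_mul_atTop ha)
    exact this.eventually_ge_atTop 1
  filter_upwards [h1] with m hm
  have hG := ml_gamma_pos a k ha hk m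
  rw [Real.norm_of_nonneg (by positivity), div_le_iff₀ hG]
  have hl := ml_gamma_lower R _ hR hm
  have e1 : R ^ (a * m + k - 1) = (2 * x + 1) ^ m * R ^ (k - 1) := by
    rw [show a * m + k - 1 = a * m + (k - 1) by ring, Real.rpow_add hR, Real.rpow_mul hR.le, hRa,
      Real.rpow_natCast]
  have e2 : R ^ (1 - k) * R ^ (k - 1) = 1 := by
    rw [← Real.rpow_add hR]; simp
  have e3 : Real.exp R * Real.exp (-R) = 1 := by rw [← Real.exp_add]; simp
  calc x ^ m ≤ ((1 / 2) * (2 * x + 1)) ^ m := by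
        apply pow_le_pow_left₀ hx; linarith
    _ = (Real.exp R * R ^ (1 - k) * (1 / 2) ^ m) * (R ^ (a * m + k - 1) * Real.exp (-R)) := by
        rw [e1, mul_pow]
        calc (1 / 2 : ℝ) ^ m * (2 * x + 1) ^ m
            = (Real.exp R * Real.exp (-R)) * (R ^ (1 - k) * R ^ (k - 1)) *
              ((1 / 2 : ℝ) ^ m * (2 * x + 1) ^ m) := by rw [e2, e3]; ring
          _ = _ := by ring
    _ ≤ _ := by gcongr

lemma ml_norm (a k x : ℝ) (ha : 0 < a) (hk : 0 < k) (m : ℕ) :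
    ‖x ^ m / Real.Gamma (a * m + k)‖ = |x| ^ m / Real.Gamma (a * m + k) := by
  rw [norm_div, norm_pow, Real.norm_eq_abs, Real.norm_of_nonneg (ml_gamma_pos a k ha hk m).le]

lemma ml_summable (a k x : ℝ) (ha : 0 < a) (hk : 0 < k) :
    Summable fun m : ℕ => x ^ m / Real.Gamma (a * m + k) := by
  refine Summable.of_norm ?_
  simp_rw [ml_norm a k x ha hk]
  exact ml_summable_nonneg a k |x| ha hk (abs_nonneg x)

lemma ml_continuous (a k : ℝ) (ha : 0 < a) (hk : 0 < k) : Continuous (mittagLeffler a k) := by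
  rw [continuous_iff_continuousAt]
  intro x
  have : ContinuousOn (mittagLeffler a k) (Metric.ball 0 (|x| + 1)) := by
    refine continuousOn_tsum (u := fun m : ℕ => (|x| + 1) ^ m / Real.Gamma (a * m + k))
      (fun m => by fun_prop) (ml_summable a k _ ha hk) ?_
    intro m y hy
    rw [ml_norm a k y ha hk]
    have := ml_gamma_pos a k ha hk m
    have hy' : |y| ≤ |x| + 1 := by
      have := mem_ball_zero_iff.1 hy
      rw [Real.norm_eq_abs] at this; exact this.le
    gcongr
  exact this.continuousAt (Metric.isOpen_ball.mem_nhds (by simp))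

lemma ml_zero (a k : ℝ) : mittagLeffler a k 0 = 1 / Real.Gamma k := by
  unfold mittagLeffler
  rw [tsum_eq_single 0]
  · simp
  · intro m hm; simp [hm]

lemma ml_rec (a k x : ℝ) (ha : 0 < a) (hk : 0 < k) :
    mittagLeffler a k x = 1 / Real.Gamma k + x * mittagLeffler a (k + a) x := by
  unfold mittagLeffler
  rw [(ml_summable a k x ha hk).tsum_eq_zero_add, ← tsum_mul_left]
  congr 1
  · simp
  · refine tsum_congr fun m => ?_
    push_cast
    rw [show a * (m + 1 : ℝ) + k = a * m + (k + a) by ring]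
    ring

/-- Fractional integration of the Mittag-Leffler function. -/
lemma ml_conv (a k b g t : ℝ) (ha : 0 < a) (hk : 0 < k) (hb : 0 < b) (ht : 0 < t) :
    ∫ s in (0:ℝ)..t, (t - s) ^ (b - 1) * (s ^ (k - 1) * mittagLeffler a k (-g * s ^ a))
      = Real.Gamma b * (t ^ (k + b - 1) * mittagLeffler a (k + b) (-g * t ^ a)) := by
  -- the terms of the series
  let F : ℕ → ℝ → ℝ := fun m s =>
    ((-g) ^ m / Real.Gamma (a * m + k)) * (s ^ ((a * m + k) - 1) * (t - s) ^ (b - 1))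
  have hFint : ∀ m, IntervalIntegrable (F m) volume 0 t := fun m =>
    (ml_beta_int (a * m + k) b t (by positivity) hb ht).const_mul _
  have hpow : ∀ s : ℝ, 0 < s → ∀ m : ℕ, s ^ (a * m + k - 1) = (s ^ a) ^ m * s ^ (k - 1) := by
    intro s hs m
    rw [show a * m + k - 1 = a * m + (k - 1) by ring, Real.rpow_add hs, Real.rpow_mul hs.le,
      Real.rpow_natCast]
  have hpow2 : ∀ m : ℕ, t ^ (a * m + k + b - 1) = (t ^ a) ^ m * t ^ (k + b - 1) := by
    intro m
    rw [show a * m + k + b - 1 = a * m + (k + b - 1) by ring, Real.rpow_add ht, Real.rpow_mul ht.le,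
      Real.rpow_natCast]
  have hval : ∀ (c : ℝ) (m : ℕ), (c ^ m / Real.Gamma (a * m + k)) *
      ∫ s in (0:ℝ)..t, (s ^ ((a * m + k) - 1) * (t - s) ^ (b - 1))
      = Real.Gamma b * t ^ (k + b - 1) * ((c * t ^ a) ^ m / Real.Gamma (a * m + (k + b))) := by
    intro c m
    rw [ml_beta _ _ _ (by positivity) hb ht, hpow2, mul_pow, ← add_assoc]
    have := (ml_gamma_pos a k ha hk m).ne'
    field_simp
  have hFval : ∀ m, ∫ s in Ioc 0 t, F m s
      = Real.Gamma b * t ^ (k + b - 1) * ((-g * t ^ a) ^ m / Real.Gamma (a * m + (k + b))) := by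
    intro m
    rw [← intervalIntegral.integral_of_le ht.le, ← hval, intervalIntegral.integral_const_mul]
  have hFnorm : ∀ m, ∫ s in Ioc 0 t, ‖F m s‖
      = Real.Gamma b * t ^ (k + b - 1) * ((|g| * t ^ a) ^ m / Real.Gamma (a * m + (k + b))) := by
    intro m
    rw [← hval, ← intervalIntegral.integral_const_mul, intervalIntegral.integral_of_le ht.le]
    refine setIntegral_congr_fun measurableSet_Ioc fun s hs => ?_
    have h1 : 0 ≤ s ^ ((a * m + k) - 1) := Real.rpow_nonneg hs.1.le _
    have h2 : 0 ≤ (t - s) ^ (b - 1) := Real.rpow_nonneg (by linarith [hs.2]) _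
    simp only [F]
    rw [norm_mul, ml_norm a k _ ha hk, abs_neg, Real.norm_of_nonneg (mul_nonneg h1 h2)]
  have hS := hasSum_integral_of_summable_integral_norm (μ := volume.restrict (Ioc 0 t)) (F := F)
    (fun m => (intervalIntegrable_iff_integrableOn_Ioc_of_le ht.le).1 (hFint m))
    (by
      simp_rw [hFnorm]
      exact (ml_summable a (k + b) _ ha (by positivity)).mul_left _)
  simp_rw [hFval] at hS
  have hS2 := (ml_summable a (k + b) (-g * t ^ a) ha (by positivity)).hasSum.mul_left
    (Real.Gamma b * t ^ (k + b - 1))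
  have := hS.unique hS2
  rw [intervalIntegral.integral_of_le ht.le]
  unfold mittagLeffler
  rw [← mul_assoc, ← this]
  refine setIntegral_congr_fun measurableSet_Ioc fun s hs => ?_
  simp only [F]
  rw [← tsum_mul_left, ← tsum_mul_left]
  refine tsum_congr fun m => ?_
  rw [hpow s hs.1, mul_pow]
  ring

lemma ml_comp_continuous (a k g : ℝ) (ha : 0 < a) (hk : 0 < k) :
    Continuous fun s : ℝ => mittagLeffler a k (-g * s ^ a) :=
  (ml_continuous a k ha hk).comp (continuous_const.mul (Real.continuous_rpow_const ha.le))

lemma ml_conv_int (a k b g t : ℝ) (ha : 0 < a) (hk : 0 < k) (hb : 0 < b) (ht : 0 < t) :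
    IntervalIntegrable
      (fun s => (t - s) ^ (b - 1) * (s ^ (k - 1) * mittagLeffler a k (-g * s ^ a))) volume 0 t := by
  have := (ml_beta_int k b t hk hb ht).mul_continuousOn
    (ml_comp_continuous a k g ha hk).continuousOn
  refine this.congr ?_
  intro s _
  simp only
  ring

lemma ml_kernel (a c t : ℝ) (ha : 0 < a) :
    ∫ s in c..t, (t - s) ^ (a - 1) = (t - c) ^ a / a := by
  rw [intervalIntegral.integral_comp_sub_left (fun x => x ^ (a - 1)) t,
    integral_rpow (Or.inl (by linarith))]
  simp [Real.zero_rpow ha.ne']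

lemma ml_kernel_int (a c t : ℝ) (ha : 0 < a) :
    IntervalIntegrable (fun s => (t - s) ^ (a - 1)) volume c t := by
  have := (intervalIntegral.intervalIntegrable_rpow' (a := t - c) (b := t - t) (r := a - 1)
    (by linarith)).comp_sub_left t
  simpa using this

lemma ml_density_conv_int (a g t b : ℝ) (ha : 0 < a) (hb : 0 < b) (ht : 0 < t) :
    IntervalIntegrable (fun s => (t - s) ^ (b - 1) * mlDensity a g s) volume 0 t := by
  refine ((ml_conv_int a a b g t ha ha hb ht).const_mul g).congr ?_
  intro s _
  simp only [mlDensity]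
  ring

lemma ml_density_conv (a g t b : ℝ) (ha : 0 < a) (hb : 0 < b) (ht : 0 < t) :
    ∫ s in (0:ℝ)..t, (t - s) ^ (b - 1) * mlDensity a g s
      = g * (Real.Gamma b * (t ^ (a + b - 1) * mittagLeffler a (a + b) (-g * t ^ a))) := by
  rw [← ml_conv a a b g t ha ha hb ht, ← intervalIntegral.integral_const_mul]
  refine intervalIntegral.integral_congr fun s _ => ?_
  simp only [mlDensity]
  ring

/-- The Volterra equation. -/
lemma ml_volterra (a g t : ℝ) (ha : 0 < a) (ht : 0 < t) :
    Real.Gamma a * mlDensity a g t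
      = g * (t ^ (a - 1) - ∫ s in (0:ℝ)..t, (t - s) ^ (a - 1) * mlDensity a g s) := by
  rw [ml_density_conv a g t a ha ha ht, mlDensity, ml_rec a a _ ha ha]
  have hG := (Real.Gamma_pos_of_pos ha).ne'
  have e : t ^ (a + a - 1) = t ^ (a - 1) * t ^ a := by
    rw [← Real.rpow_add ht]; congr 1; ring
  rw [e]
  field_simp
  ring

lemma ml_density_continuousOn (a g : ℝ) (ha : 0 < a) : ContinuousOn (mlDensity a g) (Ioi 0) := by
  unfold mlDensity
  refine ContinuousOn.mul (continuousOn_const.mul ?_) (ml_comp_continuous a a g ha ha).continuousOn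
  exact fun x hx => (Real.continuousAt_rpow_const x _ (Or.inl (ne_of_gt hx))).continuousWithinAt

/-- Positivity of the density. -/
lemma ml_density_nonneg (a g : ℝ) (ha : 0 < a) (ha1 : a < 1) (hg : 0 < g) (t1 : ℝ) (ht1 : 0 < t1) :
    0 ≤ mlDensity a g t1 := by
  by_contra! hneg
  have hG := Real.Gamma_pos_of_pos ha
  set e : ℝ → ℝ := fun s => mittagLeffler a a (-g * s ^ a) with he
  have hec : Continuous e := ml_comp_continuous a a g ha ha
  have hf : ∀ s, mlDensity a g s = g * s ^ (a - 1) * e s := fun s => rfl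
  have he0 : 0 < e 0 := by
    simp only [he, Real.zero_rpow ha.ne', mul_zero, ml_zero]; positivity
  -- the first zero
  let Z : Set ℝ := Icc 0 t1 ∩ {s | e s ≤ 0}
  have hZc : IsCompact Z := isCompact_Icc.inter_right (isClosed_le hec continuous_const)
  have he1 : e t1 ≤ 0 := by
    by_contra! h
    have : 0 < mlDensity a g t1 := by rw [hf]; positivity
    linarith
  have hZn : Z.Nonempty := ⟨t1, ⟨ht1.le, le_rfl⟩, he1⟩
  obtain ⟨t0, ⟨ht0Z, ht0e⟩, hmin⟩ := hZc.exists_isLeast hZn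
  have ht0e : e t0 ≤ 0 := ht0e
  have ht0 : 0 < t0 := by
    rcases ht0Z.1.lt_or_eq with h | h
    · exact h
    · rw [← h] at ht0e; linarith
  have hpos : ∀ s, 0 < s → s < t0 → 0 < mlDensity a g s := by
    intro s hs hst
    have : 0 < e s := by
      by_contra! h
      have := hmin ⟨⟨hs.le, hst.le.trans ht0Z.2⟩, h⟩
      linarith
    rw [hf]; positivity
  have hf0 : mlDensity a g t0 ≤ 0 := by
    rw [hf]; exact mul_nonpos_of_nonneg_of_nonpos (by positivity) ht0e
  -- choose the starting point
  obtain ⟨d, hd0, hdt, hd⟩ : ∃ d : ℝ, 0 < d ∧ d ≤ t0 / 2 ∧ 2 * g * (d ^ a / a) < Real.Gamma a := by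
    have hc : Continuous fun d : ℝ => 2 * g * (d ^ a / a) :=
      continuous_const.mul ((Real.continuous_rpow_const ha.le).div_const a)
    have h1 : ∀ᶠ d in nhdsWithin (0:ℝ) (Ioi 0), 2 * g * (d ^ a / a) < Real.Gamma a := by
      refine (hc.continuousAt.continuousWithinAt.eventually_lt continuousWithinAt_const ?_)
      simpa [Real.zero_rpow ha.ne'] using hG
    have h2 : ∀ᶠ d in nhdsWithin (0:ℝ) (Ioi 0), d ≤ t0 / 2 :=
      (eventually_le_nhds (by positivity)).filter_mono nhdsWithin_le_nhds
    obtain ⟨d, ⟨h1, h2⟩, h3⟩ := ((h1.and h2).and self_mem_nhdsWithin).exists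
    exact ⟨d, h3, h2, h1⟩
  have hcont : ContinuousOn (mlDensity a g) (Icc (t0 - d) t0) :=
    (ml_density_continuousOn a g ha).mono fun s hs => by
      have := hs.1
      exact show (0:ℝ) < s by linarith
  obtain ⟨t, htm, hmax⟩ := isCompact_Icc.exists_isMaxOn ⟨t0 - d, le_rfl, by linarith⟩ hcont
  have hmax' : ∀ s, t0 - d ≤ s → s ≤ t0 → mlDensity a g s ≤ mlDensity a g t :=
    fun s h1 h2 => hmax ⟨h1, h2⟩
  have hft : 0 < mlDensity a g t :=
    (hpos (t0 - d) (by linarith) (by linarith)).trans_le (hmax' _ le_rfl (by linarith))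
  have htt0 : t < t0 := by
    rcases htm.2.lt_or_eq with h | h
    · exact h
    · rw [h] at hft; linarith
  have htd := htm.1
  have ht : 0 < t := by linarith
  -- the two Volterra equations
  have hV0 := ml_volterra a g t0 ha ht0
  have hV := ml_volterra a g t ha ht
  have hI0 := ml_density_conv_int a g t0 a ha ha ht0
  have hI := ml_density_conv_int a g t a ha ha ht
  have hI0a : IntervalIntegrable (fun s => (t0 - s) ^ (a - 1) * mlDensity a g s) volume 0 t :=
    hI0.mono_set (by
      rw [uIcc_of_le ht.le, uIcc_of_le ht0.le]; exact Icc_subset_Icc_right htt0.le)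
  have hI0b : IntervalIntegrable (fun s => (t0 - s) ^ (a - 1) * mlDensity a g s) volume t t0 :=
    hI0.mono_set (by
      rw [uIcc_of_le htt0.le, uIcc_of_le ht0.le]; exact Icc_subset_Icc_left ht.le)
  have hsplit := intervalIntegral.integral_add_adjacent_intervals hI0a hI0b
  set q : ℝ := (t0 / t) ^ (a - 1) with hq
  have hA : ∫ s in (0:ℝ)..t, (t0 - s) ^ (a - 1) * mlDensity a g s
      ≤ q * ∫ s in (0:ℝ)..t, (t - s) ^ (a - 1) * mlDensity a g s := by
    rw [← intervalIntegral.integral_const_mul]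
    refine intervalIntegral.integral_mono_on_of_le_Ioo ht.le hI0a (hI.const_mul q) fun s hs => ?_
    rw [← mul_assoc]
    refine mul_le_mul_of_nonneg_right ?_ (hpos s hs.1 (hs.2.trans htt0)).le
    have hts : 0 < t - s := by linarith [hs.2]
    rw [hq, ← Real.mul_rpow (by positivity) hts.le]
    refine Real.rpow_le_rpow_of_nonpos (by positivity) ?_ (by linarith)
    rw [div_mul_eq_mul_div, div_le_iff₀ ht]
    nlinarith [hs.1]
  have hB : ∫ s in t..t0, (t0 - s) ^ (a - 1) * mlDensity a g s
      ≤ (t0 - t) ^ a / a * mlDensity a g t := by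
    rw [← ml_kernel a t t0 ha, ← intervalIntegral.integral_mul_const]
    refine intervalIntegral.integral_mono_on_of_le_Ioo htt0.le hI0b
      ((ml_kernel_int a t t0 ha).mul_const _) fun s hs => ?_
    refine mul_le_mul_of_nonneg_left (hmax' s (by linarith [hs.1]) hs.2.le) ?_
    exact Real.rpow_nonneg (by linarith [hs.2]) _
  have hqt : q * t ^ (a - 1) = t0 ^ (a - 1) := by
    rw [hq, ← Real.mul_rpow (by positivity) ht.le, div_mul_cancel₀ _ ht.ne']
  have hq2 : 1 / 2 ≤ q := by
    have h1 : (2:ℝ) ^ (a - 1) ≤ q :=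
      Real.rpow_le_rpow_of_nonpos (by positivity) (by rw [div_le_iff₀ ht]; linarith) (by linarith)
    have h2 : (2:ℝ) ^ (-1 : ℝ) ≤ 2 ^ (a - 1) :=
      Real.rpow_le_rpow_of_exponent_le (by norm_num) (by linarith)
    rw [Real.rpow_neg_one] at h2
    linarith
  have hdd : (t0 - t) ^ a / a ≤ d ^ a / a := by
    have : (t0 - t) ^ a ≤ d ^ a := Real.rpow_le_rpow (by linarith) (by linarith) ha.le
    gcongr
  -- combine
  set I0 := ∫ s in (0:ℝ)..t0, (t0 - s) ^ (a - 1) * mlDensity a g s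
  set I := ∫ s in (0:ℝ)..t, (t - s) ^ (a - 1) * mlDensity a g s
  set y := mlDensity a g t
  have k1 : t0 ^ (a - 1) ≤ I0 := by
    by_contra! h
    have : 0 < g * (t0 ^ (a - 1) - I0) := mul_pos hg (by linarith)
    have h3 : Real.Gamma a * mlDensity a g t0 ≤ 0 := mul_nonpos_of_nonneg_of_nonpos hG.le hf0
    linarith
  have k2 : q * (t ^ (a - 1) - I) ≤ d ^ a / a * y := by
    have : (t0 - t) ^ a / a * y ≤ d ^ a / a * y := mul_le_mul_of_nonneg_right hdd hft.le
    nlinarith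
  have k3 : q * (Real.Gamma a * y) ≤ g * (d ^ a / a * y) := by
    rw [hV]; nlinarith
  have k4 : 1 / 2 * (Real.Gamma a * y) ≤ q * (Real.Gamma a * y) :=
    mul_le_mul_of_nonneg_right hq2 (by positivity)
  have k5 := mul_lt_mul_of_pos_right hd hft
  nlinarith

theorem mlDensity_is_probability_density
    (α γ : ℝ) (hα : α ∈ Set.Ioo (0:ℝ) 1) (hγ : 0 < γ) :
    (∀ t : ℝ, 0 < t → 0 ≤ mlDensity α γ t) ∧
    (∫ t in Set.Ioi (0:ℝ), mlDensity α γ t) = 1 := by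
  obtain ⟨ha, ha1⟩ := hα
  have hnn := ml_density_nonneg α γ ha ha1 hγ
  refine ⟨hnn, ?_⟩
  have hG := Real.Gamma_pos_of_pos ha
  have hint : ∀ t, 0 < t → IntervalIntegrable (mlDensity α γ) volume 0 t := by
    intro t ht
    simpa using ml_density_conv_int α γ t 1 ha one_pos ht
  set u : ℝ → ℝ := fun t => mittagLeffler α 1 (-γ * t ^ α) with hu
  have hFu : ∀ t, 0 < t → ∫ s in (0:ℝ)..t, mlDensity α γ s = 1 - u t := by
    intro t ht
    have h := ml_density_conv α γ t 1 ha one_pos ht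
    simp only [sub_self, Real.rpow_zero, one_mul, Real.Gamma_one, add_sub_cancel_right] at h
    rw [h, hu]
    simp only
    rw [ml_rec α 1 _ ha one_pos, Real.Gamma_one, add_comm 1 α]
    ring
  have hle : ∀ t, 0 < t → ∫ s in (0:ℝ)..t, mlDensity α γ s ≤ 1 := by
    intro t ht
    have hV := ml_volterra α γ t ha ht
    have h0 : 0 ≤ Real.Gamma α * mlDensity α γ t := mul_nonneg hG.le (hnn t ht)
    rw [hV] at h0
    have h1 := nonneg_of_mul_nonneg_right h0 hγ
    have h2 : t ^ (α - 1) * ∫ s in (0:ℝ)..t, mlDensity α γ s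
        ≤ ∫ s in (0:ℝ)..t, (t - s) ^ (α - 1) * mlDensity α γ s := by
      rw [← intervalIntegral.integral_const_mul]
      refine intervalIntegral.integral_mono_on_of_le_Ioo ht.le ((hint t ht).const_mul _)
        (ml_density_conv_int α γ t α ha ha ht) fun s hs => ?_
      refine mul_le_mul_of_nonneg_right ?_ (hnn s hs.1)
      exact Real.rpow_le_rpow_of_nonpos (by linarith [hs.2]) (by linarith [hs.1]) (by linarith)
    have h3 : 0 < t ^ (α - 1) := by positivity
    by_contra! h
    nlinarith
  have hanti : ∀ s t, 0 < s → s ≤ t → u t ≤ u s := by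
    intro s t hs hst
    have ht : 0 < t := hs.trans_le hst
    have h1 := hFu s hs
    have h2 := hFu t ht
    have hst' : IntervalIntegrable (mlDensity α γ) volume s t :=
      (hint t ht).mono_set (by
        rw [uIcc_of_le hst, uIcc_of_le ht.le]; exact Icc_subset_Icc_left hs.le)
    have h3 := intervalIntegral.integral_add_adjacent_intervals (hint s hs) hst'
    have h4 : 0 ≤ ∫ x in s..t, mlDensity α γ x :=
      intervalIntegral.integral_nonneg hst fun x hx => hnn x (hs.trans_le hx.1)
    linarith
  have hbound : ∀ t, 0 < t → u t ≤ α * Real.Gamma α / γ * t ^ (-α) := by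
    intro t ht
    have h := ml_conv α 1 α γ t ha one_pos ha ht
    have hi := ml_conv_int α 1 α γ t ha one_pos ha ht
    simp only [sub_self, Real.rpow_zero, one_mul, add_sub_cancel_left] at h hi
    have h1 : (t ^ α / α) * u t ≤
        Real.Gamma α * (t ^ α * mittagLeffler α (1 + α) (-γ * t ^ α)) := by
      rw [← h]
      have hk := ml_kernel α 0 t ha
      rw [sub_zero] at hk
      rw [← hk, ← intervalIntegral.integral_mul_const]
      refine intervalIntegral.integral_mono_on_of_le_Ioo ht.le
        ((ml_kernel_int α 0 t ha).mul_const _) hi fun s hs => ?_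
      exact mul_le_mul_of_nonneg_left (hanti s t hs.1 hs.2.le)
        (Real.rpow_nonneg (by linarith [hs.2]) _)
    have h2 : u t = 1 - γ * (t ^ α * mittagLeffler α (1 + α) (-γ * t ^ α)) := by
      simp only [hu]
      rw [ml_rec α 1 _ ha one_pos, Real.Gamma_one]
      ring
    have h3 := hle t ht
    rw [hFu t ht] at h3
    have hta : 0 < t ^ α := by positivity
    set w := t ^ α * mittagLeffler α (1 + α) (-γ * t ^ α)
    have h4 : γ * w ≤ 1 := by linarith
    rw [Real.rpow_neg ht.le]
    have h5 : γ * ((t ^ α / α) * u t) ≤ Real.Gamma α := by nlinarith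
    rw [← div_eq_mul_inv, div_div, le_div_iff₀ (by positivity)]
    have h6 : u t * (γ * t ^ α) = α * (γ * ((t ^ α / α) * u t)) := by field_simp
    rw [h6]
    gcongr
  have hu0 : Tendsto u atTop (nhds 0) := by
    have h1 : Tendsto (fun t : ℝ => α * Real.Gamma α / γ * t ^ (-α)) atTop (nhds 0) := by
      simpa using (tendsto_rpow_neg_atTop ha).const_mul (α * Real.Gamma α / γ)
    refine tendsto_of_tendsto_of_tendsto_of_le_of_le' tendsto_const_nhds h1 ?_ ?_
    · filter_upwards [eventually_gt_atTop 0] with t ht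
      have := hle t ht
      rw [hFu t ht] at this
      linarith
    · filter_upwards [eventually_gt_atTop 0] with t ht using hbound t ht
  have hF1 : Tendsto (fun t => ∫ s in (0:ℝ)..t, mlDensity α γ s) atTop (nhds 1) := by
    have : Tendsto (fun t => 1 - u t) atTop (nhds 1) := by simpa using hu0.const_sub 1
    refine this.congr' ?_
    filter_upwards [eventually_gt_atTop 0] with t ht using (hFu t ht).symm
  have hI : IntegrableOn (mlDensity α γ) (Ioi 0) := by
    refine integrableOn_Ioi_of_intervalIntegral_norm_tendsto (b := fun t : ℝ => t) (l := atTop) 1 0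
      (fun t => ?_) tendsto_id ?_
    · rcases le_or_gt t 0 with h | h
      · rw [Ioc_eq_empty (by linarith)]; exact integrableOn_empty
      · exact (intervalIntegrable_iff_integrableOn_Ioc_of_le h.le).1 (hint t h)
    · refine hF1.congr' ?_
      filter_upwards [eventually_gt_atTop 0] with t ht
      rw [intervalIntegral.integral_of_le ht.le, intervalIntegral.integral_of_le ht.le]
      exact setIntegral_congr_fun measurableSet_Ioc fun s hs =>
        (Real.norm_of_nonneg (hnn s hs.1)).symm
  exact tendsto_nhds_unique (intervalIntegral_tendsto_integral_Ioi 0 hI tendsto_id) hF1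
end
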